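/- arXiv:0810.5636 — 2 statements merged into one kernel-verified Lean document; each statement's English description precedes it below -/
import Mathlib

section
/- Suppose a POMDP ν is ergodic and there exists a set H ⊆ R such that ν(r_i ∈ H) = 1 and ν(r_i = r | s_i = s, y_i = y) ≠ 0 for every action y ∈ Y, every state s ∈ S, and every r ∈ H, where S is the finite state space of the underlying Markov chain. Then ν is value-stable. -/
open MeasureTheory Filter Finset Asymptotics
open scoped ENNReal Classical

noncomputable section

namespace RL

/-- A perception `x = (r, o)`: a reward `r ∈ R = {0, …, r_max}` together with an
observation `o ∈ O`. -/
abbrev Percept (O : Type) (rmax : ℕ) := Fin (rmax + 1) × O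

/-- A cycle `z = (y, r, o)`: an action together with the resulting perception. -/
abbrev Cycle (Y O : Type) (rmax : ℕ) := Y × Percept O rmax

/-- A deterministic policy maps a history `z_{<k}` to the next action `y_k`. -/
abbrev Policy (Y O : Type) (rmax : ℕ) := List (Cycle Y O rmax) → Y

/-- An infinite interaction sequence. -/
abbrev Traj (Y O : Type) (rmax : ℕ) := ℕ → Cycle Y O rmax

instance (Y O : Type) (rmax : ℕ) : MeasurableSpace (Cycle Y O rmax) := ⊤

/-- The reward of a cycle `z = (y, (r, o))`, as a real number. -/
def rew {Y O : Type} {rmax : ℕ} (z : Cycle Y O rmax) : ℝ := ((z.2.1 : ℕ) : ℝ)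

/-- The cylinder set of all infinite sequences extending the finite sequence `l`. -/
def cylSet {A : Type} (l : List A) : Set (ℕ → A) := {ω | ∀ i : Fin l.length, ω i.1 = l.get i}

/-- An environment: conditional probabilities `ν(x_k | z_{<k} y_k)` of the next perception
given the history, together with, for each (deterministic) policy `p`, the induced
probability measure on interaction sequences, which on cylinder sets is given by the
product of the conditional probabilities (actions being forced by the policy). -/
structure Environment (Y O : Type) [Fintype Y] [Fintype O] (rmax : ℕ) where
  cond : List (Cycle Y O rmax) → Y → Percept O rmax → ℝ
  cond_nonneg : ∀ h y x, 0 ≤ cond h y x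
  cond_sum_one : ∀ h y, ∑ x : Percept O rmax, cond h y x = 1
  P : Policy Y O rmax → Measure (Traj Y O rmax)
  P_prob : ∀ p, IsProbabilityMeasure (P p)
  P_cyl : ∀ (p : Policy Y O rmax) (h : List (Cycle Y O rmax)) (z : Cycle Y O rmax),
    P p (cylSet (h ++ [z]))
      = P p (cylSet h) * ENNReal.ofReal (if z.1 = p h then cond h z.1 z.2 else 0)

variable {Y O : Type} [Fintype Y] [Fintype O] {rmax : ℕ}

/-- The average reward `(1/m) r_{1..m}` of the first `m` steps of a trajectory. -/
def avg {Y O : Type} {rmax : ℕ} (ω : Traj Y O rmax) (m : ℕ) : ℝ :=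
  (∑ i ∈ Finset.range m, rew (ω i)) / m

/-- `V(ν,p) = V` : the average limiting value exists a.s. and equals the constant `V`. -/
def ValueIs (ν : Environment Y O rmax) (p : Policy Y O rmax) (V : ℝ) : Prop :=
  ν.P p {ω | Tendsto (avg ω) atTop (nhds V)} = 1

/-- `V̄(ν,p) = V` : the upper limiting average value is a.s. the constant `V`. -/
def UpperValueIs (ν : Environment Y O rmax) (p : Policy Y O rmax) (V : ℝ) : Prop :=
  ν.P p {ω | limsup (avg ω) atTop = V} = 1

/-- `V` is the optimal value `V*_ν` of `ν`: some policy `p_ν` achieves average value `V`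
a.s., and every policy has upper average value `≤ V` a.s. -/
def IsOptimalValue (ν : Environment Y O rmax) (V : ℝ) : Prop :=
  ∃ p, ValueIs ν p V ∧ ∀ q : Policy Y O rmax, ν.P q {ω | limsup (avg ω) atTop ≤ V} = 1

/-- An environment is explorable if it has an optimal value `V*_ν`. -/
def Explorable (ν : Environment Y O rmax) : Prop := ∃ V, IsOptimalValue ν V

/-- `V` is the upper optimal value `V̄*_ν` of `ν`. -/
def IsUpperOptimalValue (ν : Environment Y O rmax) (V : ℝ) : Prop :=
  ∃ p, UpperValueIs ν p V ∧ ∀ q : Policy Y O rmax, ν.P q {ω | limsup (avg ω) atTop ≤ V} = 1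

/-- An environment is upper explorable if it has an upper optimal value `V̄*_ν`. -/
def UpperExplorable (ν : Environment Y O rmax) : Prop := ∃ V, IsUpperOptimalValue ν V

/-- `ν(x_{<k} | y_{<k})` : the probability of the perceptions of the history `h`,
given its actions. -/
def histProbX (ν : Environment Y O rmax) (h : List (Cycle Y O rmax)) : ℝ :=
  ∏ i : Fin h.length, ν.cond (h.take i.1) (h.get i).1 (h.get i).2

/-- Replace the first `k-1` actions of the policy `p` by the actions `y_{<k}` of the
history `h`. -/
def replacePolicy (h : List (Cycle Y O rmax)) (p : Policy Y O rmax) : Policy Y O rmax :=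
  fun l => if hl : l.length < h.length then (h.get ⟨l.length, hl⟩).1 else p l

/-- The measure induced by `(p, ν)` conditional on the history `h = z_{<k}`:
`ν`-probabilities conditional on `x_{<k}`, with the first `k-1` actions of `p`
replaced by `y_{<k}`. -/
def condMeasure (ν : Environment Y O rmax) (p : Policy Y O rmax)
    (h : List (Cycle Y O rmax)) : Measure (Traj Y O rmax) :=
  ProbabilityTheory.cond (ν.P (replacePolicy h p)) (cylSet h)

/-- `P( · | z_{<k})` under policy `p` in environment `ν`. -/
def condProb (ν : Environment Y O rmax) (p : Policy Y O rmax)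
    (h : List (Cycle Y O rmax)) (A : Set (Traj Y O rmax)) : ℝ≥0∞ :=
  condMeasure ν p h A

/-- `V(ν,p,z_{<k}) = V` : conditional on `z_{<k}`, the average limiting value is a.s. `V`. -/
def CondValueIs (ν : Environment Y O rmax) (p : Policy Y O rmax)
    (h : List (Cycle Y O rmax)) (V : ℝ) : Prop :=
  condProb ν p h {ω | Tendsto (avg ω) atTop (nhds V)} = 1

/-- `V̄(ν,p,z_{<k}) = V` : conditional on `z_{<k}`, the upper limiting average value
is a.s. `V`. -/
def CondUpperValueIs (ν : Environment Y O rmax) (p : Policy Y O rmax)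
    (h : List (Cycle Y O rmax)) (V : ℝ) : Prop :=
  condProb ν p h {ω | limsup (avg ω) atTop = V} = 1

/-- `V` is the conditional optimal value `V*_ν(z_{<k})`. -/
def IsCondOptimalValue (ν : Environment Y O rmax) (h : List (Cycle Y O rmax)) (V : ℝ) : Prop :=
  ∃ p, CondValueIs ν p h V ∧
    ∀ q : Policy Y O rmax, condProb ν q h {ω | limsup (avg ω) atTop ≤ V} = 1

/-- `V` is the conditional upper optimal value `V̄*_ν(z_{<k})`. -/
def IsCondUpperOptimalValue (ν : Environment Y O rmax) (h : List (Cycle Y O rmax)) (V : ℝ) :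
    Prop :=
  ∃ p, CondUpperValueIs ν p h V ∧
    ∀ q : Policy Y O rmax, condProb ν q h {ω | limsup (avg ω) atTop ≤ V} = 1

/-- Strongly explorable: after any history of positive probability there is a conditionally
optimal value. -/
def StronglyExplorable (ν : Environment Y O rmax) : Prop :=
  ∀ h, 0 < histProbX ν h → ∃ V, IsCondOptimalValue ν h V

/-- Strongly upper explorable. -/
def StronglyUpperExplorable (ν : Environment Y O rmax) : Prop :=
  ∀ h, 0 < histProbX ν h → ∃ V, IsCondUpperOptimalValue ν h V

/-- The worst-case optimal value `W*_ν = inf_{z_{<k}} V*_ν(z_{<k})`. -/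
def Wstar (ν : Environment Y O rmax) : ℝ :=
  sInf {V | ∃ h, 0 < histProbX ν h ∧ IsCondOptimalValue ν h V}

/-- The worst-case upper optimal value `W̄*_ν = inf_{z_{<k}} V̄*_ν(z_{<k})`. -/
def WstarUpper (ν : Environment Y O rmax) : ℝ :=
  sInf {V | ∃ h, 0 < histProbX ν h ∧ IsCondUpperOptimalValue ν h V}

/-- Recoverable: after any history of positive probability, some policy attains the
upper optimal value `V̄*_ν` with conditional probability 1. -/
def Recoverable (ν : Environment Y O rmax) : Prop :=
  ∃ V, IsUpperOptimalValue ν V ∧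
    ∀ h, 0 < histProbX ν h →
      ∃ p, condProb ν p h {ω | limsup (avg ω) atTop = V} = 1

/-- The quantitative part of value-stability, with target value `W`:
rewards `r_i ∈ [0, r_max]` with `(1/n) r_{1..n} → W`, `d(k,ε) = o(k)`,
`Σ_n φ(n,ε) < ∞`, and from any history `z_{<k}` some policy `p` recovers:
`P( r_{k..k+n} − r^{pν}_{k..k+n} > d(k,ε) + nε | z_{<k} ) ≤ φ(n,ε)`. -/
def ValueStableCore (ν : Environment Y O rmax) (W : ℝ) (r : ℕ → ℝ)
    (d : ℕ → ℝ → ℝ) (φ : ℕ → ℝ → ℝ) : Prop :=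
  (∀ i, r i ∈ Set.Icc (0 : ℝ) (rmax : ℝ)) ∧
  Tendsto (fun n => (∑ i ∈ Finset.range n, r i) / n) atTop (nhds W) ∧
  (∀ ε : ℝ, 0 < ε → (fun k : ℕ => d k ε) =o[atTop] fun k : ℕ => (k : ℝ)) ∧
  (∀ ε : ℝ, 0 < ε → Summable fun n => φ n ε) ∧
  ∀ h : List (Cycle Y O rmax), ∃ p : Policy Y O rmax, ∀ ε : ℝ, 0 < ε → ∀ n : ℕ,
    condProb ν p h
      {ω | d h.length ε + n * ε <
        (∑ i ∈ Finset.Icc h.length (h.length + n), r i)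
          - ∑ i ∈ Finset.Icc h.length (h.length + n), rew (ω i)}
      ≤ ENNReal.ofReal (φ n ε)

/-- Value-stability with explicit witnesses `V = V*_ν`, `r`, `d`, `φ`. -/
def ValueStableWith (ν : Environment Y O rmax) (V : ℝ) (r : ℕ → ℝ)
    (d : ℕ → ℝ → ℝ) (φ : ℕ → ℝ → ℝ) : Prop :=
  IsOptimalValue ν V ∧ ValueStableCore ν V r d φ

/-- A value-stable environment. -/
def ValueStable (ν : Environment Y O rmax) : Prop :=
  ∃ V r d φ, ValueStableWith ν V r d φ

/-- A worst-case value-stable environment: strongly explorable, and the value-stability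
condition holds with target `W*_ν`. -/
def WorstCaseValueStable (ν : Environment Y O rmax) : Prop :=
  StronglyExplorable ν ∧ ∃ r d φ, ValueStableCore ν (Wstar ν) r d φ

/-- A policy is self-optimizing for a class `C` if it attains the optimal value `V*_ν`
in every `ν ∈ C`. -/
def SelfOptimizing (p : Policy Y O rmax) (C : Set (Environment Y O rmax)) : Prop :=
  ∀ ν ∈ C, ∀ V, IsOptimalValue ν V → ValueIs ν p V

/-- A policy is upper self-optimizing for a class `C` if it attains the upper optimal
value `V̄*_ν` in every `ν ∈ C`. -/
def UpperSelfOptimizing (p : Policy Y O rmax) (C : Set (Environment Y O rmax)) : Prop :=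
  ∀ ν ∈ C, ∀ V, IsUpperOptimalValue ν V → UpperValueIs ν p V

/-- A deterministic environment: all conditional probabilities are `0` or `1`. -/
def Deterministic (ν : Environment Y O rmax) : Prop :=
  ∀ h y x, ν.cond h y x = 0 ∨ ν.cond h y x = 1

/-- In a deterministic environment, the perception following history `h` and action `y`. -/
def pick [Nonempty O] (ν : Environment Y O rmax) (h : List (Cycle Y O rmax)) (y : Y) :
    Percept O rmax :=
  if hx : ∃ x, ν.cond h y x = 1 then hx.choose else Classical.arbitrary _

/-- The (deterministic) history generated by policy `p` in a deterministic environment. -/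
def detHist [Nonempty O] (ν : Environment Y O rmax) (p : Policy Y O rmax) :
    ℕ → List (Cycle Y O rmax)
  | 0 => []
  | n + 1 =>
      detHist ν p n ++ [(p (detHist ν p n), pick ν (detHist ν p n) (p (detHist ν p n)))]

/-- The cycle `z_n` generated by policy `p` in a deterministic environment. -/
def detZ [Nonempty O] (ν : Environment Y O rmax) (p : Policy Y O rmax) (n : ℕ) :
    Cycle Y O rmax :=
  (p (detHist ν p n), pick ν (detHist ν p n) (p (detHist ν p n)))

end RL

namespace RL

instance (S Y O : Type) (rmax : ℕ) : MeasurableSpace (S × Cycle Y O rmax) := ⊤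

/-- `ν` is a (finite) partially observable MDP with hidden state space `S`: there are an
initial state distribution, state transition probabilities and emission probabilities
(the perception `x_k` depends only on `s_k` and `y_k`, and `s_{k+1}` is independent of
`s_{<k}` given `s_k`), together with, for each policy, the induced joint probability
measure on sequences of (state, cycle) pairs, whose marginal on cycles is `ν`'s
interaction measure. -/
structure POMDPOn {Y O : Type} [Fintype Y] [Fintype O] {rmax : ℕ}
    (S : Type) [Fintype S] (ν : Environment Y O rmax) where
  init : S → ℝ
  trans : S → Y → S → ℝ
  emit : S → Y → Percept O rmax → ℝ
  init_nonneg : ∀ s, 0 ≤ init s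
  init_sum_one : ∑ s : S, init s = 1
  trans_nonneg : ∀ s y s', 0 ≤ trans s y s'
  trans_sum_one : ∀ s y, ∑ s' : S, trans s y s' = 1
  emit_nonneg : ∀ s y x, 0 ≤ emit s y x
  emit_sum_one : ∀ s y, ∑ x : Percept O rmax, emit s y x = 1
  Pjoint : Policy Y O rmax → Measure (ℕ → S × Cycle Y O rmax)
  Pjoint_prob : ∀ p, IsProbabilityMeasure (Pjoint p)
  Pjoint_cyl : ∀ (p : Policy Y O rmax) (l : List (S × Cycle Y O rmax))
      (sz : S × Cycle Y O rmax),
    Pjoint p (cylSet (l ++ [sz]))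
      = Pjoint p (cylSet l) * ENNReal.ofReal
          ((match l.getLast? with
            | none => init sz.1
            | some prev => trans prev.1 sz.2.1 sz.1) *
           (if sz.2.1 = p (l.map Prod.snd) then emit sz.1 sz.2.1 sz.2.2 else 0))
  marginal : ∀ p : Policy Y O rmax,
    (Pjoint p).map (fun ω i => (ω i).2) = ν.P p

/-- A POMDP is ergodic if there exists a policy under which the underlying Markov chain
visits each state infinitely often with probability 1. -/
def POMDPOn.Ergodic {Y O : Type} [Fintype Y] [Fintype O] {rmax : ℕ}
    {S : Type} [Fintype S] {ν : Environment Y O rmax} (M : POMDPOn S ν) : Prop :=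
  ∃ p : Policy Y O rmax,
    M.Pjoint p {ω | ∀ s : S, {i : ℕ | (ω i).1 = s}.Infinite} = 1

/-- The unit mass at a state. -/
def dirac {S : Type} (σ : Option S) : Option S → ℝ := Pi.single σ 1

lemma dirac_nonneg {S : Type} (σ : Option S) : 0 ≤ dirac σ := by
  unfold dirac
  exact Pi.single_nonneg.2 zero_le_one

lemma smul_dirac_le {S : Type} {b : Option S → ℝ} (hb : 0 ≤ b) (σ : Option S) : b σ • dirac σ ≤ b := by
  intro τ
  by_cases h : τ = σ
  · subst h
    simp [dirac]
  · simpa [dirac, Pi.single_apply, h] using hb τ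

lemma percept_le {O : Type} {rmax : ℕ} (p : Percept O rmax) : ((p.1 : ℕ) : ℝ) ≤ rmax := by
  exact_mod_cast Nat.lt_succ_iff.1 p.1.2

section Filtering

variable {Y O : Type} [Fintype Y] [Fintype O] {rmax : ℕ} {S : Type} [Fintype S]
  {ν : Environment Y O rmax}

/-- The transition weights of a POMDP, with `none` standing for the situation before the first
hidden state is drawn. -/
def POMDPOn.tr (M : POMDPOn S ν) : Option S → Y → S → ℝ
  | none, _, s => M.init s
  | some a, y, s => M.trans a y s

lemma POMDPOn.tr_nonneg (M : POMDPOn S ν) (σ : Option S) (y : Y) (s : S) : 0 ≤ M.tr σ y s := by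
  cases σ with
  | none => exact M.init_nonneg s
  | some a => exact M.trans_nonneg a y s

lemma POMDPOn.tr_sum_one (M : POMDPOn S ν) (σ : Option S) (y : Y) : ∑ s, M.tr σ y s = 1 := by
  cases σ with
  | none => exact M.init_sum_one
  | some a => exact M.trans_sum_one a y

/-- One step of the unnormalized filter: the new weights of the hidden states after the
cycle `z`. -/
def POMDPOn.step (M : POMDPOn S ν) (b : Option S → ℝ) (z : Cycle Y O rmax) : Option S → ℝ
  | none => 0
  | some s => (∑ σ, b σ * M.tr σ z.1 s) * M.emit s z.1 z.2

/-- The total mass of a weight vector. -/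
def mass (b : Option S → ℝ) : ℝ := ∑ σ, b σ

lemma mass_dirac (σ : Option S) : mass (dirac σ) = 1 := by
  simp [mass, dirac]

lemma mass_nonneg {b : Option S → ℝ} (hb : 0 ≤ b) : 0 ≤ mass b := Finset.sum_nonneg fun σ _ => hb σ

lemma mass_smul (t : ℝ) (b : Option S → ℝ) : mass (t • b) = t * mass b := by
  simp only [mass, Pi.smul_apply, smul_eq_mul, Finset.mul_sum]

lemma mass_add (b b' : Option S → ℝ) : mass (b + b') = mass b + mass b' := by
  simp [mass, Finset.sum_add_distrib]

lemma mass_mono {b b' : Option S → ℝ} (h : b ≤ b') : mass b ≤ mass b' :=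
  Finset.sum_le_sum fun σ _ => h σ

lemma eq_sum_dirac (b : Option S → ℝ) : b = ∑ σ, b σ • dirac σ := by
  funext τ
  simp [dirac, Pi.single_apply]

lemma POMDPOn.step_none (M : POMDPOn S ν) (b : Option S → ℝ) (z : Cycle Y O rmax) :
    M.step b z none = 0 := rfl

lemma POMDPOn.step_nonneg (M : POMDPOn S ν) {b : Option S → ℝ} (hb : 0 ≤ b)
    (z : Cycle Y O rmax) : 0 ≤ M.step b z := by
  intro τ
  cases τ with
  | none => exact le_rfl
  | some s =>
    exact mul_nonneg (Finset.sum_nonneg fun σ _ => mul_nonneg (hb σ) (M.tr_nonneg σ _ s))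
      (M.emit_nonneg s _ _)

lemma POMDPOn.step_mono (M : POMDPOn S ν) {b b' : Option S → ℝ} (h : b ≤ b')
    (z : Cycle Y O rmax) : M.step b z ≤ M.step b' z := by
  intro τ
  cases τ with
  | none => exact le_rfl
  | some s =>
    exact mul_le_mul_of_nonneg_right (Finset.sum_le_sum fun σ _ =>
      mul_le_mul_of_nonneg_right (h σ) (M.tr_nonneg σ _ s)) (M.emit_nonneg s _ _)

lemma POMDPOn.step_smul (M : POMDPOn S ν) (t : ℝ) (b : Option S → ℝ) (z : Cycle Y O rmax) :
    M.step (t • b) z = t • M.step b z := by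
  funext τ
  cases τ with
  | none => simp [POMDPOn.step]
  | some s =>
    simp only [POMDPOn.step, Pi.smul_apply, smul_eq_mul, mul_assoc, ← Finset.mul_sum]

lemma POMDPOn.step_add (M : POMDPOn S ν) (b b' : Option S → ℝ) (z : Cycle Y O rmax) :
    M.step (b + b') z = M.step b z + M.step b' z := by
  funext τ
  cases τ with
  | none => simp [POMDPOn.step]
  | some s => simp [POMDPOn.step, add_mul, Finset.sum_add_distrib]

lemma POMDPOn.step_dirac (M : POMDPOn S ν) (σ : Option S) (z : Cycle Y O rmax) (s : S) :
    M.step (dirac σ) z (some s) = M.tr σ z.1 s * M.emit s z.1 z.2 := by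
  simp [POMDPOn.step, dirac, Pi.single_apply]

lemma mass_eq_of_none {b : Option S → ℝ} (h : b none = 0) : mass b = ∑ s, b (some s) := by
  simp [mass, Fintype.sum_option, h]

lemma POMDPOn.sum_mass_step (M : POMDPOn S ν) (b : Option S → ℝ) (y : Y) :
    ∑ x : Percept O rmax, mass (M.step b (y, x)) = mass b := by
  simp_rw [mass_eq_of_none (M.step_none b _)]
  rw [Finset.sum_comm]
  simp only [POMDPOn.step, ← Finset.mul_sum, M.emit_sum_one, mul_one]
  rw [Finset.sum_comm]
  simp only [← Finset.mul_sum, M.tr_sum_one, mul_one, mass]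

/-- The unnormalized filter along a history. -/
def POMDPOn.filter (M : POMDPOn S ν) (b : Option S → ℝ) (l : List (Cycle Y O rmax)) :
    Option S → ℝ := l.foldl M.step b

@[simp] lemma POMDPOn.filter_nil (M : POMDPOn S ν) (b : Option S → ℝ) : M.filter b [] = b := rfl

@[simp] lemma POMDPOn.filter_cons (M : POMDPOn S ν) (b : Option S → ℝ) (z : Cycle Y O rmax)
    (l : List (Cycle Y O rmax)) : M.filter b (z :: l) = M.filter (M.step b z) l := rfl

@[simp] lemma POMDPOn.filter_append (M : POMDPOn S ν) (b : Option S → ℝ)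
    (l l' : List (Cycle Y O rmax)) : M.filter b (l ++ l') = M.filter (M.filter b l) l' := by
  simp [POMDPOn.filter]

lemma POMDPOn.filter_nonneg (M : POMDPOn S ν) {b : Option S → ℝ} (hb : 0 ≤ b)
    (l : List (Cycle Y O rmax)) : 0 ≤ M.filter b l := by
  induction l generalizing b with
  | nil => exact hb
  | cons z l ih => exact ih (M.step_nonneg hb z)

lemma POMDPOn.filter_none (M : POMDPOn S ν) {b : Option S → ℝ} (hb : b none = 0)
    (l : List (Cycle Y O rmax)) : M.filter b l none = 0 := by
  induction l generalizing b with
  | nil => exact hb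
  | cons z l ih => exact ih (M.step_none b z)

end Filtering

section Bellman

variable {Y O : Type} [Fintype Y] [Fintype O] {rmax : ℕ} {S : Type} [Fintype S]
  {ν : Environment Y O rmax}

/-- Monotone, positively homogeneous, subadditive functionals on weight vectors that are
dominated by the total mass. -/
structure IsSubMass (F : (Option S → ℝ) → ℝ) : Prop where
  smul : ∀ t : ℝ, 0 ≤ t → ∀ b, F (t • b) = t * F b
  mono : ∀ b b', b ≤ b' → F b ≤ F b'
  add_le : ∀ b b', F (b + b') ≤ F b + F b'
  le_mass : ∀ b, 0 ≤ b → F b ≤ mass b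

namespace IsSubMass

variable {F : (Option S → ℝ) → ℝ}

lemma map_zero (hF : IsSubMass F) : F 0 = 0 := by
  simpa using hF.smul 0 le_rfl 0

lemma nonneg (hF : IsSubMass F) {b : Option S → ℝ} (hb : 0 ≤ b) : 0 ≤ F b :=
  hF.map_zero ▸ hF.mono 0 b hb

lemma le_sum_dirac (hF : IsSubMass F) {b : Option S → ℝ} (hb : 0 ≤ b) :
    F b ≤ ∑ σ, b σ * F (dirac σ) := by
  conv_lhs => rw [eq_sum_dirac b]
  refine (Finset.le_sum_of_subadditive F hF.map_zero.le hF.add_le _ _).trans (le_of_eq ?_)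
  exact Finset.sum_congr rfl fun σ _ => hF.smul _ (hb σ) _

lemma mul_dirac_le (hF : IsSubMass F) {b : Option S → ℝ} (hb : 0 ≤ b) (σ : Option S) :
    b σ * F (dirac σ) ≤ F b := by
  rw [← hF.smul _ (hb σ)]
  exact hF.mono _ _ (smul_dirac_le hb σ)

lemma of_mass : IsSubMass (mass : (Option S → ℝ) → ℝ) :=
  ⟨fun t _ b => mass_smul t b, fun _ _ h => mass_mono h, fun b b' => (mass_add b b').le,
    fun _ _ => le_rfl⟩

lemma of_zero : IsSubMass (fun _ : Option S → ℝ => (0 : ℝ)) :=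
  ⟨by simp, by simp, by simp, fun _ h => mass_nonneg h⟩

end IsSubMass

/-- The Bellman operator: maximize over the action the total continuation value. -/
def POMDPOn.bell (M : POMDPOn S ν) (f : Percept O rmax → (Option S → ℝ) → ℝ)
    (b : Option S → ℝ) : ℝ :=
  ⨆ y : Y, ∑ x : Percept O rmax, f x (M.step b (y, x))

lemma POMDPOn.le_bell (M : POMDPOn S ν) (f : Percept O rmax → (Option S → ℝ) → ℝ)
    (b : Option S → ℝ) (y : Y) : ∑ x, f x (M.step b (y, x)) ≤ M.bell f b :=
  le_ciSup (f := fun y => ∑ x, f x (M.step b (y, x))) (Set.finite_range _).bddAbove y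

lemma POMDPOn.exists_bell [Nonempty Y] (M : POMDPOn S ν)
    (f : Percept O rmax → (Option S → ℝ) → ℝ) (b : Option S → ℝ) :
    ∃ y, ∑ x, f x (M.step b (y, x)) = M.bell f b :=
  exists_eq_ciSup_of_finite (f := fun y => ∑ x, f x (M.step b (y, x)))

lemma POMDPOn.bell_le [Nonempty Y] (M : POMDPOn S ν)
    {f : Percept O rmax → (Option S → ℝ) → ℝ} {b : Option S → ℝ} {a : ℝ}
    (h : ∀ y, ∑ x, f x (M.step b (y, x)) ≤ a) : M.bell f b ≤ a := ciSup_le h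

lemma POMDPOn.isSubMass_bell [Nonempty Y] (M : POMDPOn S ν)
    {f : Percept O rmax → (Option S → ℝ) → ℝ} (hf : ∀ x, IsSubMass (f x)) :
    IsSubMass (M.bell f) where
  smul t ht b := by
    simp only [POMDPOn.bell, M.step_smul, (hf _).smul t ht, ← Finset.mul_sum]
    exact (Real.mul_iSup_of_nonneg ht _).symm
  mono b b' h := M.bell_le fun y => (Finset.sum_le_sum fun x _ =>
    (hf x).mono _ _ (M.step_mono h _)).trans (M.le_bell f b' y)
  add_le b b' := M.bell_le fun y => by
    refine le_trans ?_ (add_le_add (M.le_bell f b y) (M.le_bell f b' y))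
    rw [← Finset.sum_add_distrib]
    refine Finset.sum_le_sum fun x _ => ?_
    rw [M.step_add]
    exact (hf x).add_le _ _
  le_mass b hb := M.bell_le fun y => by
    rw [← M.sum_mass_step b y]
    exact Finset.sum_le_sum fun x _ => (hf x).le_mass _ (M.step_nonneg hb _)

/-- The maximal mass of the event that, starting with slack `x`, the accumulated reward stays
above the line of slope `c` for `K` steps. -/
def POMDPOn.survive (M : POMDPOn S ν) (c : ℝ) : ℕ → ℝ → (Option S → ℝ) → ℝ
  | 0, _ => mass
  | K + 1, x => M.bell fun p b =>
      if 0 ≤ x + ((p.1 : ℕ) : ℝ) - c then M.survive c K (x + ((p.1 : ℕ) : ℝ) - c) b else 0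

/-- The maximal value of the functional `F` after `j` steps. -/
def POMDPOn.after (M : POMDPOn S ν) (F : (Option S → ℝ) → ℝ) : ℕ → (Option S → ℝ) → ℝ
  | 0 => F
  | j + 1 => M.bell fun _ => M.after F j

lemma POMDPOn.isSubMass_survive [Nonempty Y] (M : POMDPOn S ν) (c : ℝ) (K : ℕ) (x : ℝ) :
    IsSubMass (M.survive c K x) := by
  induction K generalizing x with
  | zero => exact IsSubMass.of_mass
  | succ K ih =>
    refine M.isSubMass_bell fun p => ?_
    split_ifs
    · exact ih _
    · exact IsSubMass.of_zero

lemma POMDPOn.isSubMass_after [Nonempty Y] (M : POMDPOn S ν) {F : (Option S → ℝ) → ℝ}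
    (hF : IsSubMass F) (j : ℕ) : IsSubMass (M.after F j) := by
  induction j with
  | zero => exact hF
  | succ j ih => exact M.isSubMass_bell fun _ => ih

lemma POMDPOn.survive_succ_le [Nonempty Y] (M : POMDPOn S ν) (c : ℝ) (K : ℕ) (x : ℝ)
    {b : Option S → ℝ} (hb : 0 ≤ b) : M.survive c (K + 1) x b ≤ M.survive c K x b := by
  induction K generalizing x b with
  | zero => exact (M.isSubMass_survive c 1 x).le_mass b hb
  | succ K ih =>
    refine M.bell_le fun y => le_trans (Finset.sum_le_sum fun p _ => ?_) (M.le_bell _ b y)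
    split_ifs
    · exact ih _ (M.step_nonneg hb _)
    · exact le_rfl

lemma POMDPOn.survive_antitone [Nonempty Y] (M : POMDPOn S ν) (c x : ℝ)
    {b : Option S → ℝ} (hb : 0 ≤ b) : Antitone fun K => M.survive c K x b :=
  antitone_nat_of_succ_le fun K => M.survive_succ_le c K x hb

lemma POMDPOn.mass_le_survive_zero [Nonempty Y] (M : POMDPOn S ν) (K : ℕ) {x : ℝ} (hx : 0 ≤ x)
    {b : Option S → ℝ} (hb : 0 ≤ b) : mass b ≤ M.survive 0 K x b := by
  induction K generalizing x b with
  | zero => exact le_rfl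
  | succ K ih =>
    obtain ⟨y⟩ := ‹Nonempty Y›
    refine le_trans ?_ (M.le_bell _ b y)
    rw [← M.sum_mass_step b y]
    refine Finset.sum_le_sum fun p _ => ?_
    have h : (0 : ℝ) ≤ x + ((p.1 : ℕ) : ℝ) - 0 := by
      have : (0 : ℝ) ≤ ((p.1 : ℕ) : ℝ) := Nat.cast_nonneg _
      linarith
    rw [if_pos h]
    exact ih h (M.step_nonneg hb _)

lemma POMDPOn.survive_one_eq_zero [Nonempty Y] (M : POMDPOn S ν) {c : ℝ} (hc : (rmax : ℝ) < c)
    (b : Option S → ℝ) : M.survive c 1 0 b ≤ 0 := by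
  refine M.bell_le fun y => Finset.sum_nonpos fun p _ => ?_
  have := percept_le p
  rw [if_neg (by linarith)]

end Bellman

section Potential

variable {Y O : Type} [Fintype Y] [Fintype O] {rmax : ℕ} {S : Type} [Fintype S]
  {ν : Environment Y O rmax}

/-- The exponential potential of a mode in which the functional `F`, a lower bound for the
mass of success, is weighted by `a'` and its complement by `a`. -/
def modePot (u a a' : ℝ) (F : (Option S → ℝ) → ℝ) (b : Option S → ℝ) : ℝ :=
  Real.exp u * (a * (mass b - F b) + a' * F b)

lemma mass_le_modePot {u a a' : ℝ} {F : (Option S → ℝ) → ℝ} (hF : IsSubMass F) (hu : 0 ≤ u)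
    (ha : 1 ≤ a) (ha' : 1 ≤ a') {b : Option S → ℝ} (hb : 0 ≤ b) :
    mass b ≤ modePot u a a' F b := by
  have h1 := hF.nonneg hb
  have h2 := hF.le_mass b hb
  have h3 : mass b ≤ a * (mass b - F b) + a' * F b := by nlinarith
  have h4 := Real.one_le_exp hu
  have h5 := mass_nonneg hb
  unfold modePot
  nlinarith

lemma POMDPOn.survive_potential_step [Nonempty Y] (M : POMDPOn S ν) {c l ε A : ℝ}
    (hc : c ≤ rmax) (hl : 0 < l) (hε : 0 < ε) (hA : 1 ≤ A) {Ψ : (Option S → ℝ) → ℝ} {k : ℕ}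
    {x : ℝ} (hx : 0 ≤ x) (hΨA : ∀ b, 0 ≤ b → Ψ b ≤ A * mass b)
    (hΨ : ∀ b, 0 ≤ b → ∀ x', 0 ≤ x' → Ψ b ≤ modePot (l * x') (Real.exp (l * rmax) * A)
      (A * Real.exp (-(l * ε)) ^ k) (M.survive c k x') b)
    {b : Option S → ℝ} (hb : 0 ≤ b) :
    ∃ y, ∑ p : Percept O rmax, Real.exp (l * (c - ε - ((p.1 : ℕ) : ℝ))) * Ψ (M.step b (y, p))
      ≤ modePot (l * x) (Real.exp (l * rmax) * A)
        (A * Real.exp (-(l * ε)) ^ (k + 1)) (M.survive c (k + 1) x) b := by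
  set f : Percept O rmax → (Option S → ℝ) → ℝ := fun p b =>
    if 0 ≤ x + ((p.1 : ℕ) : ℝ) - c then M.survive c k (x + ((p.1 : ℕ) : ℝ) - c) b else 0 with hf
  obtain ⟨y, hy⟩ := M.exists_bell f b
  refine ⟨y, ?_⟩
  set t := Real.exp (-(l * ε)) with ht
  have ht0 : 0 < t := Real.exp_pos _
  have ht1 : t ≤ 1 := by
    rw [ht, Real.exp_le_one_iff]
    have := mul_pos hl hε
    linarith
  set a := Real.exp (l * rmax) * A with ha
  have ha0 : 0 < a := by positivity
  have key : ∀ p : Percept O rmax,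
      Real.exp (l * (c - ε - ((p.1 : ℕ) : ℝ))) * Ψ (M.step b (y, p)) ≤
        Real.exp (l * x) * (a * (mass (M.step b (y, p)) - f p (M.step b (y, p)))
          + A * t ^ (k + 1) * f p (M.step b (y, p))) := by
    intro p
    have hb' := M.step_nonneg hb (y, p)
    set b' := M.step b (y, p)
    by_cases h : 0 ≤ x + ((p.1 : ℕ) : ℝ) - c
    · simp only [hf, if_pos h]
      set x' := x + ((p.1 : ℕ) : ℝ) - c with hx'
      have hG1 := (M.isSubMass_survive c k x').nonneg hb'
      have hG2 := (M.isSubMass_survive c k x').le_mass b' hb'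
      have e1 : Real.exp (l * (c - ε - ((p.1 : ℕ) : ℝ))) * Real.exp (l * x')
          = Real.exp (l * x) * t := by
        rw [ht, ← Real.exp_add, ← Real.exp_add]
        congr 1
        rw [hx']
        ring
      calc _ ≤ Real.exp (l * (c - ε - ((p.1 : ℕ) : ℝ))) * modePot (l * x') a (A * t ^ k)
            (M.survive c k x') b' := by
            gcongr
            exact hΨ b' hb' x' h
        _ = Real.exp (l * x) * (t * (a * (mass b' - M.survive c k x' b'))
            + A * t ^ (k + 1) * M.survive c k x' b') := by
            unfold modePot
            rw [← mul_assoc, e1]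
            ring
        _ ≤ _ := by
            have h0 : 0 ≤ a * (mass b' - M.survive c k x' b') :=
              mul_nonneg ha0.le (by linarith)
            have h1 := mul_le_of_le_one_left h0 ht1
            exact mul_le_mul_of_nonneg_left (by linarith) (Real.exp_pos _).le
    · simp only [hf, if_neg h]
      have hm := mass_nonneg hb'
      push Not at h
      calc _ ≤ Real.exp (l * (c - ε - ((p.1 : ℕ) : ℝ))) * (A * mass b') := by
            gcongr
            exact hΨA b' hb'
        _ ≤ Real.exp (l * x + l * rmax) * (A * mass b') := by
            gcongr
            rw [← mul_add]
            gcongr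
            have : (0 : ℝ) ≤ ((p.1 : ℕ) : ℝ) := Nat.cast_nonneg _
            linarith
        _ = _ := by
            rw [Real.exp_add, ha]
            ring
  refine (Finset.sum_le_sum fun p _ => key p).trans (le_of_eq ?_)
  rw [← Finset.mul_sum, Finset.sum_add_distrib, ← Finset.mul_sum, ← Finset.mul_sum,
    Finset.sum_sub_distrib, M.sum_mass_step, hy]
  rfl

lemma POMDPOn.after_potential_step [Nonempty Y] (M : POMDPOn S ν) {c l ε a a' : ℝ}
    (hc : c ≤ rmax) (hl : 0 < l) (hε : 0 < ε) {F : (Option S → ℝ) → ℝ}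
    (hF : IsSubMass F) (ha : 1 ≤ a) (ha' : 1 ≤ a') {Ψ : (Option S → ℝ) → ℝ} {j : ℕ}
    (hΨ : ∀ b, 0 ≤ b → Ψ b ≤ modePot (l * rmax * j) a a' (M.after F j) b)
    {b : Option S → ℝ} (hb : 0 ≤ b) :
    ∃ y, ∑ p : Percept O rmax, Real.exp (l * (c - ε - ((p.1 : ℕ) : ℝ))) * Ψ (M.step b (y, p))
      ≤ modePot (l * rmax * (j + 1 : ℕ)) a a' (M.after F (j + 1)) b := by
  obtain ⟨y, hy⟩ := M.exists_bell (fun _ => M.after F j) b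
  refine ⟨y, ?_⟩
  have key : ∀ p : Percept O rmax,
      Real.exp (l * (c - ε - ((p.1 : ℕ) : ℝ))) * Ψ (M.step b (y, p)) ≤
        Real.exp (l * rmax * (j + 1 : ℕ)) * (a * (mass (M.step b (y, p))
          - M.after F j (M.step b (y, p))) + a' * M.after F j (M.step b (y, p))) := by
    intro p
    have hb' := M.step_nonneg hb (y, p)
    set b' := M.step b (y, p)
    have h1 := mass_le_modePot (u := l * rmax * j) (M.isSubMass_after hF j) (by positivity)
      ha ha' hb'
    have h2 := (mass_nonneg hb').trans h1
    calc _ ≤ Real.exp (l * (c - ε - ((p.1 : ℕ) : ℝ)))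
          * modePot (l * rmax * j) a a' (M.after F j) b' := by
          gcongr
          exact hΨ b' hb'
      _ ≤ Real.exp (l * rmax) * modePot (l * rmax * j) a a' (M.after F j) b' := by
          gcongr
          have : (0 : ℝ) ≤ ((p.1 : ℕ) : ℝ) := Nat.cast_nonneg _
          linarith
      _ = _ := by
          unfold modePot
          rw [← mul_assoc, ← Real.exp_add]
          congr 2
          push_cast
          ring
  refine (Finset.sum_le_sum fun p _ => key p).trans (le_of_eq ?_)
  rw [← Finset.mul_sum, Finset.sum_add_distrib, ← Finset.mul_sum, ← Finset.mul_sum,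
    Finset.sum_sub_distrib, M.sum_mass_step, hy]
  rfl

lemma modePot_le {l R p t A : ℝ} {L j : ℕ} (hl : 0 < l) (hR : 0 ≤ R)
    (hlp : l * R * (L + 1) ≤ p / 2) (ht : t ≤ 1 / 2) (hA : 0 ≤ A)
    (hj : j ≤ L) {F : (Option S → ℝ) → ℝ} (hF : IsSubMass F) {b : Option S → ℝ} (hb : 0 ≤ b)
    (hFb : p * mass b ≤ F b) :
    modePot (l * R * j) (Real.exp (l * R) * A) (A * t) F b ≤ A * mass b := by
  have h1 := hF.nonneg hb
  have h2 := hF.le_mass b hb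
  have hm := mass_nonneg hb
  have he : 1 ≤ Real.exp (l * R) := Real.one_le_exp (by positivity)
  have hj' : (j : ℝ) ≤ L := by exact_mod_cast hj
  calc modePot (l * R * j) (Real.exp (l * R) * A) (A * t) F b
      ≤ Real.exp (l * R * L) * (Real.exp (l * R) * A * (mass b - F b)
        + Real.exp (l * R) * A * (F b / 2)) := by
        unfold modePot
        have h3 : A * t * F b ≤ Real.exp (l * R) * A * (F b / 2) := by
          have : t * F b ≤ Real.exp (l * R) * (F b / 2) := by nlinarith
          nlinarith
        have h4 : 0 ≤ Real.exp (l * R) * A * (mass b - F b)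
            + Real.exp (l * R) * A * (F b / 2) := by
          have : 0 ≤ mass b - F b := by linarith
          positivity
        have h5 : l * R * j ≤ l * R * L := by gcongr
        have h6 := Real.exp_le_exp.2 h5
        have h7 := Real.exp_pos (l * R * j)
        nlinarith
    _ = A * Real.exp (l * R * (L + 1)) * (mass b - F b / 2) := by
        rw [mul_add (l * R), mul_one, Real.exp_add]
        ring
    _ ≤ A * Real.exp (p / 2) * (Real.exp (-(p / 2)) * mass b) := by
        have h8 : mass b - F b / 2 ≤ Real.exp (-(p / 2)) * mass b := by
          have := Real.add_one_le_exp (-(p / 2))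
          nlinarith
        have h9 : 0 ≤ mass b - F b / 2 := by linarith
        gcongr
    _ = A * mass b := by
        rw [mul_assoc, ← mul_assoc (Real.exp _), ← Real.exp_add]
        simp

/-- If some slope-`c` survival probability is bounded below uniformly in the horizon and the
corresponding start can be reached from everywhere, there is an exponential potential for
staying above slope `c - ε`. -/
lemma POMDPOn.exists_potential [Nonempty Y] (M : POMDPOn S ν) {c : ℝ} (hc : c ≤ rmax)
    {p : ℝ} (hp : 0 < p) {L : ℕ}
    (hreach : ∀ (K : ℕ) (b : Option S → ℝ), 0 ≤ b →
      ∃ j ≤ L, p * mass b ≤ M.after (M.survive c K 0) j b)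
    {ε : ℝ} (hε : 0 < ε) :
    ∃ l₀ > 0, ∀ l, 0 < l → l ≤ l₀ → ∃ (A : ℝ) (Ψ : (Option S → ℝ) → ℝ), 1 ≤ A ∧
      ∀ b, 0 ≤ b → mass b ≤ Ψ b ∧ Ψ b ≤ A * mass b ∧
        ∃ y, ∑ x : Percept O rmax,
          Real.exp (l * (c - ε - ((x.1 : ℕ) : ℝ))) * Ψ (M.step b (y, x)) ≤ Ψ b := by
  have hR : (0 : ℝ) ≤ rmax := Nat.cast_nonneg _
  refine ⟨p / (2 * ((rmax + 1) * (L + 1))), by positivity, fun l hl hle => ?_⟩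
  have hlp : l * rmax * (L + 1) ≤ p / 2 := by
    have h := (le_div_iff₀ (by positivity)).1 hle
    have : 0 ≤ l * (L + 1) := by positivity
    nlinarith
  set t := Real.exp (-(l * ε)) with ht
  have ht0 : 0 < t := Real.exp_pos _
  have ht1 : t < 1 := by
    rw [ht, Real.exp_lt_one_iff]
    have := mul_pos hl hε
    linarith
  obtain ⟨K, hK⟩ := exists_pow_lt_of_lt_one (by norm_num : (0 : ℝ) < 1 / 2) ht1
  have htK : 0 < t ^ K := pow_pos ht0 K
  have hK0 : K ≠ 0 := by
    rintro rfl
    norm_num at hK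
  set A := (t ^ K)⁻¹ with hA
  have hAK : A * t ^ K = 1 := inv_mul_cancel₀ htK.ne'
  have hA1 : 1 ≤ A := (one_le_inv₀ htK).2 (by linarith)
  set a := Real.exp (l * rmax) * A with ha
  have ha1 : 1 ≤ a := by
    have : 1 ≤ Real.exp (l * rmax) := Real.one_le_exp (by positivity)
    nlinarith
  set T : (Option S → ℝ) → Set ℝ := fun b =>
    {v | ∃ k ≤ K, ∃ x, 0 ≤ x ∧ v = modePot (l * x) a (A * t ^ k) (M.survive c k x) b} ∪
    {v | ∃ j ≤ L, v = modePot (l * rmax * j) a (A * t ^ K) (M.after (M.survive c K 0) j) b}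
    with hT
  have hlow : ∀ b, 0 ≤ b → ∀ v ∈ T b, mass b ≤ v := by
    rintro b hb v (⟨k, hk, x, hx, rfl⟩ | ⟨j, hj, rfl⟩)
    · refine mass_le_modePot (M.isSubMass_survive c k x) (by positivity) ha1 ?_ hb
      rw [← hAK]
      exact mul_le_mul_of_nonneg_left (pow_le_pow_of_le_one ht0.le ht1.le hk) (by linarith)
    · exact mass_le_modePot (M.isSubMass_after (M.isSubMass_survive c K 0) j) (by positivity)
        ha1 hAK.ge hb
  have hbdd : ∀ b, 0 ≤ b → BddBelow (T b) := fun b hb => ⟨mass b, hlow b hb⟩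
  set Ψ : (Option S → ℝ) → ℝ := fun b => sInf (T b) with hΨ
  have hne : ∀ b, (T b).Nonempty := fun b => ⟨_, Or.inr ⟨0, Nat.zero_le _, rfl⟩⟩
  have hrun : ∀ k ≤ K, ∀ b, 0 ≤ b → ∀ x, 0 ≤ x →
      Ψ b ≤ modePot (l * x) a (A * t ^ k) (M.survive c k x) b := fun k hk b hb x hx =>
    csInf_le (hbdd b hb) (Or.inl ⟨k, hk, x, hx, rfl⟩)
  have hrst : ∀ j ≤ L, ∀ b, 0 ≤ b →
      Ψ b ≤ modePot (l * rmax * j) a (A * t ^ K) (M.after (M.survive c K 0) j) b :=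
    fun j hj b hb => csInf_le (hbdd b hb) (Or.inr ⟨j, hj, rfl⟩)
  have hstart : ∀ b, 0 ≤ b → ∃ j ≤ L, modePot (l * rmax * j) a (A * t ^ K)
      (M.after (M.survive c K 0) j) b ≤ A * mass b := fun b hb => by
    obtain ⟨j, hj, h⟩ := hreach K b hb
    exact ⟨j, hj, modePot_le hl hR hlp hK.le (by linarith) hj
      (M.isSubMass_after (M.isSubMass_survive c K 0) j) hb h⟩
  have hup : ∀ b, 0 ≤ b → Ψ b ≤ A * mass b := fun b hb => by
    obtain ⟨j, hj, h⟩ := hstart b hb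
    exact (hrst j hj b hb).trans h
  have hrunstep : ∀ k, k + 1 ≤ K → ∀ x, 0 ≤ x → ∀ b, 0 ≤ b → ∃ y, ∑ p : Percept O rmax,
      Real.exp (l * (c - ε - ((p.1 : ℕ) : ℝ))) * Ψ (M.step b (y, p))
        ≤ modePot (l * x) a (A * t ^ (k + 1)) (M.survive c (k + 1) x) b :=
    fun k hk x hx b hb => M.survive_potential_step hc hl hε hA1 hx hup
      (hrun k (by omega)) hb
  have hrststep : ∀ j ≤ L, ∀ b, 0 ≤ b → ∃ y, ∑ p : Percept O rmax,
      Real.exp (l * (c - ε - ((p.1 : ℕ) : ℝ))) * Ψ (M.step b (y, p))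
        ≤ modePot (l * rmax * j) a (A * t ^ K) (M.after (M.survive c K 0) j) b := by
    intro j hj b hb
    cases j with
    | zero =>
      obtain ⟨k, rfl⟩ := Nat.exists_eq_succ_of_ne_zero hK0
      simpa [POMDPOn.after] using hrunstep k le_rfl 0 le_rfl b hb
    | succ j =>
      exact M.after_potential_step hc hl hε (M.isSubMass_survive c K 0) ha1 hAK.ge
        (hrst j (by omega)) hb
  refine ⟨A, Ψ, hA1, fun b hb => ⟨le_csInf (hne b) (hlow b hb), hup b hb, ?_⟩⟩
  obtain ⟨y, hy⟩ := Finite.exists_min fun y : Y => ∑ p : Percept O rmax,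
    Real.exp (l * (c - ε - ((p.1 : ℕ) : ℝ))) * Ψ (M.step b (y, p))
  refine ⟨y, le_csInf (hne b) ?_⟩
  rintro v (⟨k, hk, x, hx, rfl⟩ | ⟨j, hj, rfl⟩)
  · cases k with
    | zero =>
      obtain ⟨j, hj, h⟩ := hstart b hb
      obtain ⟨y', hy'⟩ := hrststep j hj b hb
      refine (hy y').trans (hy'.trans (h.trans ?_))
      have h1 := Real.one_le_exp (by positivity : 0 ≤ l * x)
      have h2 : 0 ≤ A * mass b := mul_nonneg (by linarith) (mass_nonneg hb)
      simp only [modePot, POMDPOn.survive]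
      nlinarith
    | succ k =>
      obtain ⟨y', hy'⟩ := hrunstep k hk x hx b hb
      exact (hy y').trans hy'
  · obtain ⟨y', hy'⟩ := hrststep j hj b hb
    exact (hy y').trans hy'

end Potential

section PolicySum

variable {Y O : Type} [Fintype Y] [Fintype O] {rmax : ℕ} {S : Type} [Fintype S]
  {ν : Environment Y O rmax}

/-- The sum of `f` over all histories of length `n` whose actions follow the policy `q`. -/
def polSum {Y O : Type} [Fintype O] {rmax : ℕ} :
    ℕ → Policy Y O rmax → (List (Cycle Y O rmax) → ℝ) → ℝ
  | 0, _, f => f []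
  | n + 1, q, f => ∑ x : Percept O rmax,
      polSum n (fun l => q ((q [], x) :: l)) (fun l => f ((q [], x) :: l))

lemma polSum_mono {Y O : Type} [Fintype O] {rmax : ℕ} {n : ℕ} {q : Policy Y O rmax}
    {f g : List (Cycle Y O rmax) → ℝ} (h : ∀ l, l.length = n → f l ≤ g l) :
    polSum n q f ≤ polSum n q g := by
  induction n generalizing q f g with
  | zero => exact h [] rfl
  | succ n ih => exact Finset.sum_le_sum fun x _ => ih fun l hl => h _ (by simp [hl])

lemma polSum_congr {Y O : Type} [Fintype O] {rmax : ℕ} {n : ℕ} {q : Policy Y O rmax}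
    {f g : List (Cycle Y O rmax) → ℝ} (h : ∀ l, l.length = n → f l = g l) :
    polSum n q f = polSum n q g :=
  le_antisymm (polSum_mono fun l hl => (h l hl).le) (polSum_mono fun l hl => (h l hl).ge)

lemma polSum_add {Y O : Type} [Fintype O] {rmax : ℕ} (n : ℕ) (q : Policy Y O rmax)
    (f g : List (Cycle Y O rmax) → ℝ) :
    polSum n q (fun l => f l + g l) = polSum n q f + polSum n q g := by
  induction n generalizing q f g with
  | zero => rfl
  | succ n ih => simp only [polSum, ih, Finset.sum_add_distrib]

lemma polSum_const_mul {Y O : Type} [Fintype O] {rmax : ℕ} (n : ℕ) (q : Policy Y O rmax)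
    (t : ℝ) (f : List (Cycle Y O rmax) → ℝ) :
    polSum n q (fun l => t * f l) = t * polSum n q f := by
  induction n generalizing q f with
  | zero => rfl
  | succ n ih => simp only [polSum, ih, Finset.mul_sum]

lemma polSum_succ_last {Y O : Type} [Fintype O] {rmax : ℕ} (n : ℕ) (q : Policy Y O rmax)
    (f : List (Cycle Y O rmax) → ℝ) :
    polSum (n + 1) q f = polSum n q fun l => ∑ x : Percept O rmax, f (l ++ [(q l, x)]) := by
  induction n generalizing q f with
  | zero => rfl
  | succ n ih =>
    rw [polSum, polSum]
    exact Finset.sum_congr rfl fun x _ => ih _ _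

lemma polSum_add_length {Y O : Type} [Fintype O] {rmax : ℕ} (n m : ℕ) (q : Policy Y O rmax)
    (f : List (Cycle Y O rmax) → ℝ) :
    polSum (n + m) q f =
      polSum n q fun l => polSum m (fun l' => q (l ++ l')) fun l' => f (l ++ l') := by
  induction n generalizing q f with
  | zero => simp [polSum]
  | succ n ih =>
    rw [Nat.succ_add, polSum, polSum]
    exact Finset.sum_congr rfl fun x _ => ih _ _

lemma POMDPOn.polSum_mass (M : POMDPOn S ν) (n : ℕ) (q : Policy Y O rmax) (b : Option S → ℝ) :
    polSum n q (fun l => mass (M.filter b l)) = mass b := by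
  induction n generalizing q b with
  | zero => rfl
  | succ n ih => simp only [polSum, M.filter_cons, ih, M.sum_mass_step]

/-- The total reward of a history. -/
def totalRew {Y O : Type} {rmax : ℕ} (l : List (Cycle Y O rmax)) : ℝ := (l.map rew).sum

@[simp] lemma totalRew_nil {Y O : Type} {rmax : ℕ} :
    totalRew ([] : List (Cycle Y O rmax)) = 0 := rfl

@[simp] lemma totalRew_cons {Y O : Type} {rmax : ℕ} (z : Cycle Y O rmax)
    (l : List (Cycle Y O rmax)) : totalRew (z :: l) = rew z + totalRew l := by
  simp [totalRew]

@[simp] lemma totalRew_append {Y O : Type} {rmax : ℕ} (l l' : List (Cycle Y O rmax)) :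
    totalRew (l ++ l') = totalRew l + totalRew l' := by
  simp [totalRew]

lemma totalRew_nonneg {Y O : Type} {rmax : ℕ} (l : List (Cycle Y O rmax)) : 0 ≤ totalRew l := by
  induction l with
  | nil => simp
  | cons z l ih =>
    rw [totalRew_cons]
    exact add_nonneg (Nat.cast_nonneg _) ih

lemma totalRew_le {Y O : Type} {rmax : ℕ} (l : List (Cycle Y O rmax)) :
    totalRew l ≤ rmax * l.length := by
  induction l with
  | nil => simp
  | cons z l ih =>
    have := percept_le z.2
    simp only [totalRew_cons, List.length_cons, rew]
    push_cast
    linarith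

end PolicySum

section LowerBound

variable {Y O : Type} [Fintype Y] [Fintype O] {rmax : ℕ} {S : Type} [Fintype S]
  {ν : Environment Y O rmax}

lemma exp_mul_le_one_add_exp_mul {l l' x : ℝ} (hl' : 0 ≤ l') (h : l' ≤ l) :
    Real.exp (l' * x) ≤ 1 + Real.exp (l * x) := by
  rcases le_total 0 x with hx | hx
  · have : Real.exp (l' * x) ≤ Real.exp (l * x) :=
      Real.exp_le_exp.2 (mul_le_mul_of_nonneg_right h hx)
    linarith
  · have : Real.exp (l' * x) ≤ 1 := Real.exp_le_one_iff.2 (mul_nonpos_of_nonneg_of_nonpos hl' hx)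
    linarith [Real.exp_pos (l * x)]

lemma eventually_mul_exp_neg_le {c : ℝ} (hc : 0 < c) (a : ℝ) :
    ∀ᶠ k : ℕ in atTop, ∀ m ≥ k, a * Real.exp (-(c * m)) ≤ 1 / (m : ℝ) ^ 2 := by
  have h := (tendsto_pow_const_mul_const_pow_of_abs_lt_one 2 (r := Real.exp (-c))
    (by rw [abs_of_pos (Real.exp_pos _)]; exact Real.exp_lt_one_iff.2 (by linarith))).const_mul a
  rw [mul_zero] at h
  have h' := (h.eventually_le_const zero_lt_one).and (eventually_gt_atTop 0)
  refine (eventually_forall_ge_atTop.2 h').mono fun k hk m hm => ?_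
  obtain ⟨h1, h2⟩ := hk m hm
  have h3 : (0 : ℝ) < (m : ℝ) ^ 2 := by positivity
  rw [le_div_iff₀ h3]
  refine le_trans (le_of_eq ?_) h1
  rw [← Real.exp_nat_mul]
  ring_nf

lemma exists_slow_sequence (a : ℕ → ℝ) {c : ℕ → ℝ} (hc : ∀ J, 0 < c J) :
    ∃ (j : ℕ → ℕ) (n₀ : ℕ), Monotone j ∧ Tendsto j atTop atTop ∧
      ∀ n ≥ n₀, a (j n) * Real.exp (-(c (j n) * n)) ≤ 1 / (n : ℝ) ^ 2 := by
  obtain ⟨φ, hφ, hφa⟩ := Filter.extraction_forall_of_eventually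
    (P := fun J k => ∀ m ≥ k, a J * Real.exp (-(c J * m)) ≤ 1 / (m : ℝ) ^ 2)
    fun J => eventually_mul_exp_neg_le (hc J) _
  have j_ge : ∀ J n, φ J ≤ n → J ≤ Nat.findGreatest (fun J => φ J ≤ n) n := fun J n h =>
    Nat.le_findGreatest ((hφ.id_le J).trans h) h
  refine ⟨fun n => Nat.findGreatest (fun J => φ J ≤ n) n, φ 0, fun m n h =>
    Nat.findGreatest_mono (fun J hJ => le_trans hJ h) h,
    tendsto_atTop.2 fun J => (eventually_ge_atTop (φ J)).mono fun n h => j_ge J n h,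
    fun n hn => hφa _ n ?_⟩
  exact Nat.findGreatest_spec (P := fun J => φ J ≤ n) (Nat.zero_le n) hn

lemma tendsto_cesaro_add_div {j : ℕ → ℕ} (hj : Tendsto j atTop atTop) :
    Tendsto (fun n : ℕ => (∑ i ∈ Finset.range n, 2 / ((j i : ℝ) + 1) + n / ((j n : ℝ) + 1)) / n)
      atTop (nhds 0) := by
  have inv_tendsto : Tendsto (fun n => 1 / ((j n : ℝ) + 1)) atTop (nhds 0) :=
    tendsto_one_div_add_atTop_nhds_zero_nat.comp hj
  have h1 : Tendsto (fun n => 2 / ((j n : ℝ) + 1)) atTop (nhds 0) := by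
    simpa [div_eq_mul_inv] using inv_tendsto.const_mul 2
  have h2 := h1.cesaro.add inv_tendsto
  rw [add_zero] at h2
  refine h2.congr' ((eventually_gt_atTop 0).mono fun n hn => ?_)
  have h3 : (n : ℝ) ≠ 0 := by positivity
  have h4 : (j n : ℝ) + 1 ≠ 0 := by positivity
  beta_reduce
  rw [add_div, div_right_comm, div_self h3, inv_mul_eq_div]

/-- Following, at time `n`, an action that is optimal for the potential `Ψ (j n)`. -/
lemma POMDPOn.polSum_exp_potential_le (M : POMDPOn S ν) {lam A v a : ℕ → ℝ}
    {Ψ : ℕ → (Option S → ℝ) → ℝ} {y : ℕ → (Option S → ℝ) → Y} {j : ℕ → ℕ}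
    (lam_pos : ∀ J, 0 < lam J) (lam_anti : Antitone lam) (hA : ∀ J, 1 ≤ A J)
    (hΨ : ∀ J b, 0 ≤ b → mass b ≤ Ψ J b ∧ Ψ J b ≤ A J * mass b)
    (hy : ∀ J b, 0 ≤ b → ∑ x : Percept O rmax,
      Real.exp (lam J * (v J - ((x.1 : ℕ) : ℝ))) * Ψ J (M.step b (y J b, x)) ≤ Ψ J b)
    (a_mono : Monotone a) (A_le : ∀ J, A J ≤ a J) (a_succ : ∀ J, a (J + 1) = A (J + 1) * (1 + a J))
    (j_mono : Monotone j) {b : Option S → ℝ} (hb : 0 ≤ b) (n : ℕ) :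
    polSum n (fun l => y (j l.length) (M.filter b l)) (fun l =>
      Real.exp (lam (j n) * (∑ i ∈ Finset.range n, v (j i) - totalRew l)) *
        Ψ (j n) (M.filter b l)) ≤ a (j n) * mass b := by
  set q : Policy Y O rmax := fun l => y (j l.length) (M.filter b l)
  set D : ℕ → ℝ := fun n => ∑ i ∈ Finset.range n, v (j i) with hD
  have hstep : ∀ n, polSum (n + 1) q (fun l =>
      Real.exp (lam (j n) * (D (n + 1) - totalRew l)) * Ψ (j n) (M.filter b l)) ≤
      polSum n q (fun l => Real.exp (lam (j n) * (D n - totalRew l)) * Ψ (j n) (M.filter b l)) := by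
    intro n
    rw [polSum_succ_last]
    refine polSum_mono fun l hl => ?_
    have h1 := mul_le_mul_of_nonneg_left (hy (j n) _ (M.filter_nonneg hb l))
      (Real.exp_pos (lam (j n) * (D n - totalRew l))).le
    refine le_trans (le_of_eq ?_) h1
    rw [Finset.mul_sum]
    refine Finset.sum_congr rfl fun x _ => ?_
    rw [← mul_assoc, ← Real.exp_add, show q l = y (j n) (M.filter b l) by rw [← hl]]
    simp only [M.filter_append, M.filter_cons, M.filter_nil, totalRew_append, totalRew_cons,
      totalRew_nil, rew, hD, Finset.sum_range_succ]
    congr 2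
    ring
  induction n with
  | zero =>
    simp only [polSum, Finset.sum_range_zero, totalRew_nil, sub_zero, mul_zero, Real.exp_zero,
      one_mul, M.filter_nil]
    exact (hΨ _ b hb).2.trans (mul_le_mul_of_nonneg_right (A_le _) (mass_nonneg hb))
  | succ n ih =>
    have ih' := (hstep n).trans ih
    rcases (j_mono n.le_succ).eq_or_lt with h | h
    · rw [← h]
      exact ih'
    replace h : j n < j (n + 1) := h
    obtain ⟨J, hJ⟩ : ∃ J, j (n + 1) = J + 1 := ⟨j (n + 1) - 1, by omega⟩
    have hnJ : j n ≤ J := by omega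
    rw [hJ]
    calc _ ≤ polSum (n + 1) q (fun l => A (J + 1) * (mass (M.filter b l) +
          Real.exp (lam (j n) * (D (n + 1) - totalRew l)) * Ψ (j n) (M.filter b l))) := by
          refine polSum_mono fun l _ => ?_
          have hf := M.filter_nonneg hb l
          have h1 := (hΨ (J + 1) _ hf).2
          have h2 := (hΨ (j n) _ hf).1
          have h3 := exp_mul_le_one_add_exp_mul (x := D (n + 1) - totalRew l) (lam_pos (J + 1)).le
            (lam_anti (show j n ≤ J + 1 by omega))
          have h4 := mass_nonneg hf
          have h5 := Real.exp_pos (lam (j n) * (D (n + 1) - totalRew l))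
          have hA0 : 0 ≤ A (J + 1) := zero_le_one.trans (hA _)
          calc _ ≤ (1 + Real.exp (lam (j n) * (D (n + 1) - totalRew l))) *
                (A (J + 1) * mass (M.filter b l)) := by
                  refine mul_le_mul h3 h1 (h4.trans (hΨ _ _ hf).1) (by linarith)
            _ = A (J + 1) * (mass (M.filter b l) +
                Real.exp (lam (j n) * (D (n + 1) - totalRew l)) * mass (M.filter b l)) := by ring
            _ ≤ _ := by gcongr
      _ ≤ A (J + 1) * (mass b + a (j n) * mass b) := by
          rw [polSum_const_mul, polSum_add, M.polSum_mass]
          have hA0 : 0 ≤ A (J + 1) := zero_le_one.trans (hA _)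
          gcongr
      _ ≤ a (J + 1) * mass b := by
          rw [a_succ]
          have hA0 : 0 ≤ A (J + 1) := zero_le_one.trans (hA _)
          have := mass_nonneg hb
          have := a_mono hnJ
          calc _ = A (J + 1) * (1 + a (j n)) * mass b := by ring
            _ ≤ _ := by gcongr

/-- A sequence of potentials with slopes increasing to `V` yields policies whose total reward
falls below `V n` by more than `o(n)` only with summable probability. -/
lemma POMDPOn.exists_policy_lower (M : POMDPOn S ν) {V : ℝ}
    (hpot : ∀ J : ℕ, ∃ l₀ > 0, ∀ l, 0 < l → l ≤ l₀ →
      ∃ (A : ℝ) (Ψ : (Option S → ℝ) → ℝ), 1 ≤ A ∧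
      ∀ b, 0 ≤ b → mass b ≤ Ψ b ∧ Ψ b ≤ A * mass b ∧
        ∃ y, ∑ x : Percept O rmax,
          Real.exp (l * (V - 2 / ((J : ℝ) + 1) - ((x.1 : ℕ) : ℝ))) * Ψ (M.step b (y, x)) ≤ Ψ b) :
    ∃ e ψ : ℕ → ℝ, Tendsto (fun n : ℕ => e n / n) atTop (nhds 0) ∧ Summable ψ ∧ (∀ n, 0 ≤ ψ n) ∧
      ∀ b : Option S → ℝ, 0 ≤ b → ∃ q : Policy Y O rmax, ∀ n : ℕ,
        polSum n q (fun l => if e n < V * n - totalRew l then mass (M.filter b l) else 0)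
          ≤ ψ n * mass b := by
  choose l₀ hl₀ hpot using hpot
  set lam : ℕ → ℝ := fun J => (Finset.range (J + 1)).inf' ⟨0, by simp⟩ l₀ with hlam
  have lam_pos : ∀ J, 0 < lam J := fun J => (Finset.lt_inf'_iff _).2 fun i _ => hl₀ i
  have lam_anti : Antitone lam := fun i j h =>
    Finset.inf'_mono _ (Finset.range_mono (by omega)) _
  choose A Ψ hA hΨ using fun J => hpot J (lam J) (lam_pos J) (Finset.inf'_le _ (by simp))
  have hy : ∀ J b, ∃ y, 0 ≤ b → ∑ x : Percept O rmax,
      Real.exp (lam J * (V - 2 / ((J : ℝ) + 1) - ((x.1 : ℕ) : ℝ))) * Ψ J (M.step b (y, x))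
        ≤ Ψ J b := by
    intro J b
    by_cases hb : 0 ≤ b
    · obtain ⟨y, hy⟩ := (hΨ J b hb).2.2
      exact ⟨y, fun _ => hy⟩
    · obtain ⟨y, -⟩ := (hΨ J 0 le_rfl).2.2
      exact ⟨y, fun h => absurd h hb⟩
  choose y hy using hy
  set a : ℕ → ℝ := fun J => Nat.rec (A 0) (fun i x => A (i + 1) * (1 + x)) J with ha
  have a_succ : ∀ J, a (J + 1) = A (J + 1) * (1 + a J) := fun J => rfl
  have a_pos : ∀ J, 0 ≤ a J := by
    intro J
    induction J with
    | zero => exact zero_le_one.trans (hA 0)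
    | succ J ih =>
      rw [a_succ]
      exact mul_nonneg (zero_le_one.trans (hA _)) (by linarith)
  have a_mono : Monotone a := monotone_nat_of_le_succ fun J => by
    rw [a_succ]
    nlinarith [hA (J + 1), a_pos J]
  have A_le : ∀ J, A J ≤ a J := by
    intro J
    cases J with
    | zero => exact le_rfl
    | succ J =>
      rw [a_succ]
      nlinarith [hA (J + 1), a_pos J]
  obtain ⟨j, n₀, j_mono, j_tendsto, hj⟩ :=
    exists_slow_sequence a (c := fun J => lam J / ((J : ℝ) + 1)) fun J =>
      div_pos (lam_pos J) (by positivity)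
  refine ⟨fun n => ∑ i ∈ Finset.range n, 2 / ((j i : ℝ) + 1) + n / ((j n : ℝ) + 1),
    fun n => if n₀ ≤ n then 1 / (n : ℝ) ^ 2 else 1, tendsto_cesaro_add_div j_tendsto, ?_, ?_, ?_⟩
  · refine (Real.summable_one_div_nat_pow.2 one_lt_two).congr_atTop
      ((eventually_ge_atTop n₀).mono fun n hn => ?_)
    beta_reduce
    rw [if_pos hn]
  · intro n
    beta_reduce
    split_ifs <;> positivity
  intro b hb
  set q : Policy Y O rmax := fun l => y (j l.length) (M.filter b l)
  set D : ℕ → ℝ := fun n => ∑ i ∈ Finset.range n, (V - 2 / ((j i : ℝ) + 1)) with hD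
  have hmain := M.polSum_exp_potential_le (v := fun J => V - 2 / ((J : ℝ) + 1)) (y := y)
    lam_pos lam_anti hA (fun J b hb => ⟨(hΨ J b hb).1, (hΨ J b hb).2.1⟩) hy a_mono A_le a_succ
    j_mono hb
  refine ⟨q, fun n => ?_⟩
  beta_reduce
  split_ifs with hn
  · have h1 : polSum n q (fun l => if ∑ i ∈ Finset.range n, 2 / ((j i : ℝ) + 1) +
        n / ((j n : ℝ) + 1) < V * n - totalRew l then mass (M.filter b l) else 0) ≤
        Real.exp (-(lam (j n) / (j n + 1) * n)) * polSum n q (fun l =>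
          Real.exp (lam (j n) * (D n - totalRew l)) * Ψ (j n) (M.filter b l)) := by
      rw [← polSum_const_mul]
      refine polSum_mono fun l _ => ?_
      have hf := M.filter_nonneg hb l
      have h2 := (hΨ (j n) _ hf).1
      have h4 := mass_nonneg hf
      split_ifs with hlt
      · rw [← mul_assoc, ← Real.exp_add]
        have hDn : D n = V * n - ∑ i ∈ Finset.range n, 2 / ((j i : ℝ) + 1) := by
          simp [hD, Finset.sum_sub_distrib, mul_comm]
        have h6 : 0 ≤ -(lam (j n) / (j n + 1) * n) + lam (j n) * (D n - totalRew l) := by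
          have : -(lam (j n) / (j n + 1) * n) + lam (j n) * (D n - totalRew l)
            = lam (j n) * (D n - totalRew l - n / ((j n : ℝ) + 1)) := by ring
          rw [this]
          exact mul_nonneg (lam_pos _).le (by linarith)
        calc _ ≤ Ψ (j n) (M.filter b l) := h2
          _ ≤ _ := le_mul_of_one_le_left (h4.trans h2) (Real.one_le_exp h6)
      · exact mul_nonneg (Real.exp_pos _).le (mul_nonneg (Real.exp_pos _).le (h4.trans h2))
    refine h1.trans ?_
    calc _ ≤ Real.exp (-(lam (j n) / (j n + 1) * n)) * (a (j n) * mass b) := by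
          gcongr
          exact hmain n
      _ = a (j n) * Real.exp (-(lam (j n) / (j n + 1) * n)) * mass b := by ring
      _ ≤ _ := mul_le_mul_of_nonneg_right (hj n hn) (mass_nonneg hb)
  · rw [one_mul]
    refine le_trans (polSum_mono fun l _ => ?_) (M.polSum_mass n q b).le
    split_ifs
    · exact le_rfl
    · exact mass_nonneg (M.filter_nonneg hb l)

end LowerBound

section UpperBound

variable {Y O : Type} [Fintype Y] [Fintype O] {rmax : ℕ} {S : Type} [Fintype S]
  {ν : Environment Y O rmax}

/-- Starting from `x`, the total reward minus `c` per step stays nonnegative for `K` steps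
(or until the history ends). -/
def StaysNonneg {Y O : Type} {rmax : ℕ} (c : ℝ) : ℕ → ℝ → List (Cycle Y O rmax) → Prop
  | 0, _, _ => True
  | _ + 1, _, [] => True
  | K + 1, x, z :: l => 0 ≤ x + rew z - c ∧ StaysNonneg c K (x + rew z - c) l

/-- The number of times from which the reward surplus stays nonnegative for `K` steps. -/
def countStays {Y O : Type} {rmax : ℕ} (c : ℝ) (K : ℕ) : List (Cycle Y O rmax) → ℝ
  | [] => 0
  | z :: l => (if StaysNonneg c K 0 (z :: l) then 1 else 0) + countStays c K l

lemma countStays_le_cons {Y O : Type} {rmax : ℕ} (c : ℝ) (K : ℕ) (z : Cycle Y O rmax)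
    (l : List (Cycle Y O rmax)) : countStays c K l ≤ countStays c K (z :: l) := by
  rw [countStays]
  split_ifs <;> linarith

lemma countStays_le_append {Y O : Type} {rmax : ℕ} (c : ℝ) (K : ℕ)
    (l l' : List (Cycle Y O rmax)) : countStays c K l' ≤ countStays c K (l ++ l') := by
  induction l with
  | nil => exact le_rfl
  | cons z l ih => exact ih.trans (countStays_le_cons c K z _)

lemma countStays_le_length {Y O : Type} {rmax : ℕ} (c : ℝ) (K : ℕ) (l : List (Cycle Y O rmax)) :
    countStays c K l ≤ l.length := by
  induction l with
  | nil => simp [countStays]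
  | cons z l ih =>
    rw [countStays, List.length_cons]
    push_cast
    split_ifs <;> linarith

lemma exists_prefix_of_not_staysNonneg {Y O : Type} {rmax : ℕ} {c : ℝ} {K : ℕ} {x : ℝ}
    {l : List (Cycle Y O rmax)} (h : ¬ StaysNonneg c K x l) :
    ∃ l₁ l₂, l = l₁ ++ l₂ ∧ l₁ ≠ [] ∧ x + totalRew l₁ - c * l₁.length < 0 := by
  induction K generalizing x l with
  | zero => exact absurd trivial h
  | succ K ih =>
    cases l with
    | nil => exact absurd trivial h
    | cons z l =>
      by_cases h0 : 0 ≤ x + rew z - c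
      · obtain ⟨l₁, l₂, rfl, -, hlt⟩ := ih fun h' => h ⟨h0, h'⟩
        refine ⟨z :: l₁, l₂, rfl, by simp, ?_⟩
        simp only [totalRew_cons, List.length_cons]
        push_cast
        linarith
      · refine ⟨[z], l, rfl, by simp, ?_⟩
        simp only [totalRew_cons, totalRew_nil, List.length_cons, List.length_nil]
        push_cast
        linarith

lemma totalRew_sub_le_countStays {Y O : Type} {rmax : ℕ} {c : ℝ} (hc : 0 ≤ c) (K : ℕ)
    (l : List (Cycle Y O rmax)) : totalRew l - c * l.length ≤ rmax * countStays c K l := by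
  induction hn : l.length using Nat.strong_induction_on generalizing l with
  | _ n ih =>
    subst hn
    have hR : (0 : ℝ) ≤ rmax := Nat.cast_nonneg _
    cases l with
    | nil => simp [countStays]
    | cons z l =>
      by_cases h : StaysNonneg c K 0 (z :: l)
      · have h1 := ih l.length (by simp) l rfl
        have h2 := percept_le z.2
        rw [countStays, if_pos h, totalRew_cons, List.length_cons, rew]
        push_cast
        linarith
      · obtain ⟨l₁, l₂, hl, hne, hlt⟩ := exists_prefix_of_not_staysNonneg h
        have hpos := List.length_pos_iff.2 hne
        rw [hl]
        have h1 := ih l₂.length (by rw [hl, List.length_append]; omega) l₂ rfl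
        have h2 := mul_le_mul_of_nonneg_left (countStays_le_append c K l₁ l₂) hR
        rw [totalRew_append, List.length_append]
        push_cast
        linarith

lemma POMDPOn.polSum_staysNonneg_le (M : POMDPOn S ν) (c : ℝ) {K n : ℕ} (h : K ≤ n) (x : ℝ)
    (q : Policy Y O rmax) (b : Option S → ℝ) :
    polSum n q (fun l => if StaysNonneg c K x l then mass (M.filter b l) else 0)
      ≤ M.survive c K x b := by
  induction K generalizing n q x b with
  | zero => simp [StaysNonneg, M.polSum_mass, POMDPOn.survive]
  | succ K ih =>
    obtain ⟨n, rfl⟩ : ∃ m, n = m + 1 := ⟨n - 1, by omega⟩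
    rw [polSum]
    refine le_trans (Finset.sum_le_sum fun p _ => ?_) (M.le_bell _ b (q []))
    simp only [StaysNonneg, M.filter_cons, rew]
    by_cases h0 : 0 ≤ x + ((p.1 : ℕ) : ℝ) - c
    · simpa only [h0, true_and, if_true] using ih (by omega) _ _ _
    · simp only [h0, false_and, if_false]
      have := polSum_const_mul n (fun l => q ((q [], p) :: l)) 0 fun _ => 0
      simp only [mul_zero, zero_mul] at this
      exact this.le

lemma POMDPOn.polSum_countStays_le (M : POMDPOn S ν) [Nonempty Y] {c g : ℝ} {K : ℕ} (hg0 : 0 ≤ g)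
    (hg : ∀ s, M.survive c K 0 (dirac (some s)) ≤ g) (n : ℕ) (q : Policy Y O rmax)
    {b : Option S → ℝ} (hb : 0 ≤ b) (hb0 : b none = 0) :
    polSum n q (fun l => countStays c K l * mass (M.filter b l)) ≤ (g * n + K) * mass b := by
  induction n generalizing q b with
  | zero =>
    simp only [polSum, countStays, zero_mul]
    have := mass_nonneg hb
    positivity
  | succ n ih =>
    have hm := mass_nonneg hb
    rcases Nat.lt_or_ge K (n + 1) with h | h
    · have h1 : polSum (n + 1) q (fun l => countStays c K l * mass (M.filter b l)) =
          polSum (n + 1) q (fun l => (if StaysNonneg c K 0 l then mass (M.filter b l) else 0) +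
            countStays c K l.tail * mass (M.filter b l)) := by
        refine polSum_congr fun l hl => ?_
        cases l with
        | nil => simp at hl
        | cons z l =>
          rw [countStays, List.tail_cons]
          split_ifs <;> ring
      rw [h1, polSum_add]
      have h2 : M.survive c K 0 b ≤ g * mass b := by
        refine ((M.isSubMass_survive c K 0).le_sum_dirac hb).trans ?_
        rw [mass_eq_of_none hb0, Fintype.sum_option, hb0, zero_mul, zero_add, mul_comm,
          Finset.sum_mul]
        exact Finset.sum_le_sum fun s _ => mul_le_mul_of_nonneg_left (hg s) (hb _)
      have h3 : polSum (n + 1) q (fun l => countStays c K l.tail * mass (M.filter b l)) ≤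
          (g * n + K) * mass b := by
        simp only [polSum, List.tail_cons, M.filter_cons]
        refine (Finset.sum_le_sum fun x _ => ih _ (M.step_nonneg hb _) (M.step_none b _)).trans ?_
        rw [← Finset.mul_sum, M.sum_mass_step]
      have h4 := M.polSum_staysNonneg_le c h.le 0 q b
      push_cast
      linarith
    · calc _ ≤ polSum (n + 1) q (fun l => (K : ℝ) * mass (M.filter b l)) := by
            refine polSum_mono fun l hl => ?_
            have h1 := countStays_le_length c K l
            have h2 : (l.length : ℝ) ≤ K := by exact_mod_cast hl.trans_le h
            exact mul_le_mul_of_nonneg_right (h1.trans h2) (mass_nonneg (M.filter_nonneg hb l))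
        _ = K * mass b := by rw [polSum_const_mul, M.polSum_mass]
        _ ≤ _ := by
            have : 0 ≤ g * ((n + 1 : ℕ) : ℝ) := by positivity
            nlinarith

lemma exp_le_one_add_add_sq {x : ℝ} (hx : |x| ≤ 1) : Real.exp x ≤ 1 + x + x ^ 2 := by
  have := (abs_le.1 (Real.abs_exp_sub_one_sub_id_le hx)).2
  linarith

lemma POMDPOn.exists_exp_block_le (M : POMDPOn S ν) [Nonempty Y] {c g ε : ℝ} {K : ℕ} (hc : 0 ≤ c)
    (hε : 0 < ε) (hg0 : 0 ≤ g) (hgε : rmax * g ≤ ε)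
    (hg : ∀ s, M.survive c K 0 (dirac (some s)) ≤ g) :
    ∃ lam > 0, ∃ N : ℕ, 0 < N ∧ ∀ (q : Policy Y O rmax) (b : Option S → ℝ), 0 ≤ b → b none = 0 →
      polSum N q (fun l => Real.exp (lam * (totalRew l - (c + 3 * ε) * N)) * mass (M.filter b l))
        ≤ mass b := by
  have hR : (0 : ℝ) ≤ rmax := Nat.cast_nonneg _
  obtain ⟨N', hN'⟩ := exists_nat_ge (rmax * K / ε)
  set N := N' + 1 with hN
  have hN0 : (0 : ℝ) < N := by positivity
  have hNK : rmax * K ≤ ε * N := by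
    rw [div_le_iff₀ hε] at hN'
    rw [hN]
    push_cast
    nlinarith
  set B : ℝ := rmax + c + 3 * ε with hB
  have hB0 : 0 < B := by positivity
  set lam : ℝ := min (1 / (B * N)) (ε / (B ^ 2 * N)) with hlam
  have hlam0 : 0 < lam := lt_min (by positivity) (by positivity)
  have hl1 : lam * (B * N) ≤ 1 := (le_div_iff₀ (by positivity)).1 (min_le_left _ _)
  have hl2 : lam * (B ^ 2 * N) ≤ ε := (le_div_iff₀ (by positivity)).1 (min_le_right _ _)
  refine ⟨lam, hlam0, N, Nat.succ_pos _, fun q b hb hb0 => ?_⟩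
  have hm := mass_nonneg hb
  have hcount := M.polSum_countStays_le hg0 hg N q hb hb0
  calc _ ≤ polSum N q (fun l => (lam * rmax) * (countStays c K l * mass (M.filter b l)) +
        (1 - 3 * lam * ε * N + lam ^ 2 * (B * N) ^ 2) * mass (M.filter b l)) := by
        refine polSum_mono fun l hl => ?_
        have h1 := totalRew_sub_le_countStays hc K l
        have h2 := totalRew_le l
        have h3 := totalRew_nonneg l
        rw [hl] at h1 h2
        set X := totalRew l - (c + 3 * ε) * N with hX
        have hXB : |X| ≤ B * N := by
          rw [abs_le]
          constructor <;> rw [hX, hB] <;> nlinarith [mul_nonneg hR hN0.le,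
            mul_nonneg hc hN0.le, mul_pos hε hN0]
        have hXlam : |lam * X| ≤ 1 := by
          rw [abs_mul, abs_of_pos hlam0]
          exact (mul_le_mul_of_nonneg_left hXB hlam0.le).trans hl1
        have h4 := exp_le_one_add_add_sq hXlam
        have h5 : X ^ 2 ≤ (B * N) ^ 2 := sq_le_sq.2 (by rwa [abs_of_pos (mul_pos hB0 hN0)])
        have h6 : Real.exp (lam * X) ≤ lam * rmax * countStays c K l +
            (1 - 3 * lam * ε * N + lam ^ 2 * (B * N) ^ 2) := by
          have h7 : lam ^ 2 * X ^ 2 ≤ lam ^ 2 * (B * N) ^ 2 := by gcongr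
          have h8 := mul_le_mul_of_nonneg_left h1 hlam0.le
          have h9 : lam * X = lam * (totalRew l - c * N) - 3 * lam * ε * N := by
            rw [hX]
            ring
          rw [mul_pow] at h4
          linarith
        calc _ ≤ (lam * rmax * countStays c K l +
            (1 - 3 * lam * ε * N + lam ^ 2 * (B * N) ^ 2)) * mass (M.filter b l) :=
              mul_le_mul_of_nonneg_right h6 (mass_nonneg (M.filter_nonneg hb l))
          _ = _ := by ring
    _ ≤ lam * rmax * ((g * N + K) * mass b) +
        (1 - 3 * lam * ε * N + lam ^ 2 * (B * N) ^ 2) * mass b := by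
        rw [polSum_add, polSum_const_mul, polSum_const_mul, M.polSum_mass]
        gcongr
    _ = (1 + lam * (rmax * g * N + rmax * K - 3 * ε * N + lam * (B ^ 2 * N) * N)) * mass b := by
        ring
    _ ≤ 1 * mass b := by
        refine mul_le_mul_of_nonneg_right ?_ hm
        have h1 := mul_le_mul_of_nonneg_right hgε hN0.le
        have h2 := mul_le_mul_of_nonneg_right hl2 hN0.le
        nlinarith
    _ = mass b := one_mul _

lemma POMDPOn.polSum_exp_le_of_block (M : POMDPOn S ν) {lam v : ℝ} (hlam : 0 < lam) (hv : 0 ≤ v)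
    {N : ℕ} (hN : 0 < N)
    (hblock : ∀ (q : Policy Y O rmax) (b : Option S → ℝ), 0 ≤ b → b none = 0 →
      polSum N q (fun l => Real.exp (lam * (totalRew l - v * N)) * mass (M.filter b l)) ≤ mass b)
    (n : ℕ) (q : Policy Y O rmax) {b : Option S → ℝ} (hb : 0 ≤ b) (hb0 : b none = 0) :
    polSum n q (fun l => Real.exp (lam * (totalRew l - v * n)) * mass (M.filter b l))
      ≤ Real.exp (lam * (rmax * N)) * mass b := by
  induction n using Nat.strong_induction_on generalizing q b with
  | _ n ih =>
    rcases Nat.lt_or_ge n N with h | h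
    · calc _ ≤ polSum n q (fun l => Real.exp (lam * (rmax * N)) * mass (M.filter b l)) := by
            refine polSum_mono fun l hl => ?_
            have h1 := totalRew_le l
            rw [hl] at h1
            have h2 : (rmax : ℝ) * n ≤ rmax * N := by gcongr
            have h3 : 0 ≤ v * n := by positivity
            have := mass_nonneg (M.filter_nonneg hb l)
            gcongr
            linarith
        _ = _ := by rw [polSum_const_mul, M.polSum_mass]
    · obtain ⟨m, rfl⟩ := Nat.exists_eq_add_of_le h
      rw [polSum_add_length]
      calc _ ≤ polSum N q (fun l => Real.exp (lam * (rmax * N)) *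
            (Real.exp (lam * (totalRew l - v * N)) * mass (M.filter b l))) := by
            refine polSum_mono fun l _ => ?_
            have h1 := ih m (by omega) (fun l' => q (l ++ l')) (M.filter_nonneg hb l)
              (M.filter_none hb0 l)
            have h2 := mul_le_mul_of_nonneg_left h1
              (Real.exp_pos (lam * (totalRew l - v * N))).le
            rw [← polSum_const_mul] at h2
            refine le_trans (le_of_eq (polSum_congr fun l' _ => ?_)) (h2.trans (le_of_eq (by ring)))
            rw [← mul_assoc, ← Real.exp_add, M.filter_append, totalRew_append]
            push_cast
            congr 2
            ring
        _ ≤ _ := by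
            rw [polSum_const_mul]
            gcongr
            exact hblock q b hb hb0

/-- If from every state the probability that the reward surplus over `c` stays nonnegative for
`K` steps tends to zero, then exponential moments of the surplus over `v > c` are bounded. -/
lemma POMDPOn.exists_exp_le (M : POMDPOn S ν) [Nonempty Y] {c v : ℝ} (hc : 0 ≤ c) (hcv : c < v)
    (hbad : ∀ δ > 0, ∃ K, ∀ s, M.survive c K 0 (dirac (some s)) ≤ δ) :
    ∃ lam > 0, ∃ A, ∀ (n : ℕ) (q : Policy Y O rmax) (b : Option S → ℝ), 0 ≤ b →
      polSum n q (fun l => Real.exp (lam * (totalRew l - v * n)) * mass (M.filter b l))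
        ≤ A * mass b := by
  have hR : (0 : ℝ) ≤ rmax := Nat.cast_nonneg _
  set ε := (v - c) / 3 with hε
  have hε0 : 0 < ε := by
    rw [hε]
    linarith
  have hvε : c + 3 * ε = v := by
    rw [hε]
    ring
  obtain ⟨K, hK⟩ := hbad (ε / (rmax + 1)) (by positivity)
  obtain ⟨lam, hlam, N, hN, hblock⟩ := M.exists_exp_block_le hc hε0 (by positivity)
    (by rw [← mul_div_assoc, div_le_iff₀ (by positivity)]; nlinarith) hK
  rw [hvε] at hblock
  have hv : 0 ≤ v := by linarith
  refine ⟨lam, hlam, Real.exp (lam * rmax) * Real.exp (lam * (rmax * N)), fun n q b hb => ?_⟩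
  have hm := mass_nonneg hb
  cases n with
  | zero =>
    simp only [polSum, totalRew_nil, CharP.cast_eq_zero, mul_zero, sub_zero, Real.exp_zero, one_mul,
      M.filter_nil]
    refine le_mul_of_one_le_left hm ?_
    exact one_le_mul_of_one_le_of_one_le (Real.one_le_exp (by positivity))
      (Real.one_le_exp (by positivity))
  | succ n =>
    have h1 : ∀ x : Percept O rmax, polSum n (fun l => q ((q [], x) :: l)) (fun l =>
        Real.exp (lam * (totalRew ((q [], x) :: l) - v * (n + 1 : ℕ))) *
          mass (M.filter b ((q [], x) :: l))) ≤
        Real.exp (lam * rmax) * (Real.exp (lam * (rmax * N)) * mass (M.step b (q [], x))) := by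
      intro x
      refine le_trans ?_ (mul_le_mul_of_nonneg_left (M.polSum_exp_le_of_block hlam hv hN hblock n
        (fun l => q ((q [], x) :: l)) (M.step_nonneg hb (q [], x)) (M.step_none b _))
        (Real.exp_pos _).le)
      rw [← polSum_const_mul]
      refine polSum_mono fun l _ => ?_
      rw [← mul_assoc, ← Real.exp_add, M.filter_cons, totalRew_cons, rew]
      refine mul_le_mul_of_nonneg_right (Real.exp_le_exp.2 ?_)
        (mass_nonneg (M.filter_nonneg (M.step_nonneg hb _) l))
      have := percept_le x
      rw [← mul_add]
      refine mul_le_mul_of_nonneg_left ?_ hlam.le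
      push_cast
      linarith
    refine (Finset.sum_le_sum fun x _ => h1 x).trans (le_of_eq ?_)
    rw [← Finset.mul_sum, ← Finset.mul_sum, M.sum_mass_step, mul_assoc]

end UpperBound

section Segments

/-- The segment of length `n` of a sequence, starting at index `k`. -/
def seg {α : Type} (ω : ℕ → α) (k n : ℕ) : List α := List.ofFn fun i : Fin n => ω (k + i)

@[simp] lemma length_seg {α : Type} (ω : ℕ → α) (k n : ℕ) : (seg ω k n).length = n := by
  simp [seg]

@[simp] lemma getElem_seg {α : Type} (ω : ℕ → α) (k n i : ℕ) (h : i < (seg ω k n).length) :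
    (seg ω k n)[i] = ω (k + i) := by
  simp [seg]

@[simp] lemma seg_zero {α : Type} (ω : ℕ → α) (k : ℕ) : seg ω k 0 = [] := by
  simp [seg]

lemma seg_succ {α : Type} (ω : ℕ → α) (k n : ℕ) : seg ω k (n + 1) = ω k :: seg ω (k + 1) n := by
  refine List.ext_getElem (by simp) fun i h₁ h₂ => ?_
  cases i with
  | zero => simp
  | succ i =>
    simp only [getElem_seg, List.getElem_cons_succ]
    congr 1
    ring

lemma seg_succ_last {α : Type} (ω : ℕ → α) (k n : ℕ) :
    seg ω k (n + 1) = seg ω k n ++ [ω (k + n)] := by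
  induction n generalizing k with
  | zero => simp [seg_succ]
  | succ n ih => rw [seg_succ, ih, seg_succ, List.cons_append, Nat.add_right_comm, Nat.add_assoc]

lemma mem_cylSet_iff {α : Type} {ω : ℕ → α} {h : List α} :
    ω ∈ cylSet h ↔ seg ω 0 h.length = h := by
  constructor
  · intro hω
    refine List.ext_getElem (by simp) fun i h₁ h₂ => ?_
    simpa using hω ⟨i, h₂⟩
  · intro hω i
    have h1 := getElem_seg ω 0 h.length i.1 (by simp)
    rw [zero_add] at h1
    rw [← h1]
    simp only [hω]
    rfl

lemma seg_mem_cylSet {α : Type} (ω : ℕ → α) (n : ℕ) : ω ∈ cylSet (seg ω 0 n) := by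
  rw [mem_cylSet_iff, length_seg]

lemma mem_cylSet_append_singleton {α : Type} {ω : ℕ → α} {h : List α} {z : α} :
    ω ∈ cylSet (h ++ [z]) ↔ ω ∈ cylSet h ∧ ω h.length = z := by
  rw [mem_cylSet_iff, mem_cylSet_iff, List.length_append, List.length_singleton, seg_succ_last,
    zero_add]
  constructor
  · intro h1
    have h2 := List.append_inj h1 (by simp)
    exact ⟨h2.1, by simpa using h2.2⟩
  · rintro ⟨h1, h2⟩
    rw [h1, h2]

end Segments

section Reachability

variable {Y O : Type} [Fintype Y] [Fintype O] {rmax : ℕ} {S : Type} [Fintype S]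
  {ν : Environment Y O rmax}

/-- The hidden state reached along a list of (state, cycle) pairs. -/
def lastState {S α : Type} (l : List (S × α)) : Option S := l.getLast?.map Prod.fst

lemma POMDPOn.Pjoint_cyl_append (M : POMDPOn S ν) (p : Policy Y O rmax)
    (l : List (S × Cycle Y O rmax)) (s : S) (z : Cycle Y O rmax) :
    M.Pjoint p (cylSet (l ++ [(s, z)])) = M.Pjoint p (cylSet l) * ENNReal.ofReal
      (M.tr (lastState l) z.1 s * (if z.1 = p (l.map Prod.snd) then M.emit s z.1 z.2 else 0)) := by
  rw [M.Pjoint_cyl]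
  unfold lastState
  cases l.getLast? <;> rfl

/-- Almost surely only transitions of positive probability occur. -/
lemma POMDPOn.ae_tr_pos (M : POMDPOn S ν) (p : Policy Y O rmax) :
    ∀ᵐ ω ∂M.Pjoint p, ∀ n, 0 < M.tr (lastState (seg ω 0 n)) (ω n).2.1 (ω n).1 := by
  have hnull : M.Pjoint p (⋃ (i : {i : List (S × Cycle Y O rmax) × (S × Cycle Y O rmax) //
      M.tr (lastState i.1) i.2.2.1 i.2.1 = 0}), cylSet (i.1.1 ++ [i.1.2])) = 0 := by
    refine measure_iUnion_null fun ⟨⟨l, s, z⟩, hi⟩ => ?_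
    simp only at hi
    rw [M.Pjoint_cyl_append, hi, zero_mul, ENNReal.ofReal_zero, mul_zero]
  refine measure_mono_null (fun ω hω => ?_) hnull
  simp only [Set.mem_compl_iff, Set.mem_ofPred_eq, not_forall] at hω
  obtain ⟨n, hn⟩ := hω
  have h0 := le_antisymm (not_lt.1 hn) (M.tr_nonneg _ _ _)
  refine Set.mem_iUnion.2 ⟨⟨(seg ω 0 n, ω n), h0⟩, ?_⟩
  exact mem_cylSet_append_singleton.2 ⟨seg_mem_cylSet ω n, by rw [length_seg]⟩

lemma POMDPOn.exists_mul_le_after_path (M : POMDPOn S ν) [Nonempty Y] (τ : ℕ → Option S)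
    (y : ℕ → Y) (hτ : ∀ n, ∃ s, τ (n + 1) = some s ∧ 0 < M.tr (τ n) (y n) s) (n d : ℕ) :
    ∃ δ > 0, ∀ F, IsSubMass F → δ * F (dirac (τ (n + d))) ≤ M.after F d (dirac (τ n)) := by
  induction d generalizing n with
  | zero => exact ⟨1, one_pos, fun F _ => (one_mul _).le⟩
  | succ d ih =>
    obtain ⟨δ, hδ, hle⟩ := ih (n + 1)
    obtain ⟨s, hs, hpos⟩ := hτ n
    obtain ⟨x, -, hx⟩ := Finset.exists_ne_zero_of_sum_ne_zero
      ((M.emit_sum_one s (y n)).trans_ne one_ne_zero)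
    have hx := (M.emit_nonneg s (y n) x).lt_of_ne' hx
    refine ⟨M.tr (τ n) (y n) s * M.emit s (y n) x * δ, by positivity, fun F hF => ?_⟩
    have hF' := M.isSubMass_after hF d
    have hnn := fun x' => M.step_nonneg (dirac_nonneg (τ n)) (y n, x')
    refine le_trans ?_ (M.le_bell (fun _ => M.after F d) (dirac (τ n)) (y n))
    refine le_trans ?_ (Finset.single_le_sum
      (f := fun x' => M.after F d (M.step (dirac (τ n)) (y n, x')))
      (fun x' _ => hF'.nonneg (hnn x')) (Finset.mem_univ x))
    refine le_trans ?_ (hF'.mul_dirac_le (hnn x) (some s))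
    rw [M.step_dirac, mul_assoc]
    refine mul_le_mul_of_nonneg_left ?_ (by positivity)
    rw [← hs]
    rw [show n + (d + 1) = n + 1 + d by omega]
    exact hle F hF

lemma lastState_seg_succ {S α : Type} (ω : ℕ → S × α) (n : ℕ) :
    lastState (seg ω 0 (n + 1)) = some (ω n).1 := by
  simp [lastState, seg_succ_last]

lemma POMDPOn.Ergodic.exists_mul_le_after {M : POMDPOn S ν} [Nonempty Y] (h : M.Ergodic)
    (σ : Option S) (s : S) :
    ∃ (j : ℕ) (δ : ℝ), 0 < δ ∧
      ∀ F, IsSubMass F → δ * F (dirac (some s)) ≤ M.after F j (dirac σ) := by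
  obtain ⟨p, hp⟩ := h
  obtain ⟨ω, hω, hpos⟩ : ∃ ω : ℕ → S × Cycle Y O rmax, (∀ s : S, {i : ℕ | (ω i).1 = s}.Infinite) ∧
      ∀ n, 0 < M.tr (lastState (seg ω 0 n)) (ω n).2.1 (ω n).1 := by
    by_contra hcon
    push Not at hcon
    have : M.Pjoint p {ω | ∀ s : S, {i : ℕ | (ω i).1 = s}.Infinite} = 0 := by
      refine measure_mono_null (fun ω hω => ?_) (M.ae_tr_pos p)
      obtain ⟨n, hn⟩ := hcon ω hω
      exact fun h' => hn.not_gt (h' n)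
    rw [this] at hp
    exact zero_ne_one hp
  have hpath := M.exists_mul_le_after_path (fun n => lastState (seg ω 0 n)) (fun n => (ω n).2.1)
    fun n => ⟨(ω n).1, lastState_seg_succ ω n, hpos n⟩
  obtain ⟨n, hn⟩ : ∃ n, lastState (seg ω 0 n) = σ := by
    cases σ with
    | none => exact ⟨0, by simp [lastState]⟩
    | some a =>
      obtain ⟨i, hi⟩ := (hω a).nonempty
      exact ⟨i + 1, by rw [lastState_seg_succ, hi]⟩
  obtain ⟨i, hi, hni⟩ := (hω s).exists_gt n
  obtain ⟨δ, hδ, hle⟩ := hpath n (i + 1 - n)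
  refine ⟨i + 1 - n, δ, hδ, fun F hF => ?_⟩
  have h1 := hle F hF
  rwa [hn, Nat.add_sub_cancel' (by omega), lastState_seg_succ, hi] at h1

lemma POMDPOn.Ergodic.exists_reach {M : POMDPOn S ν} [Nonempty Y] (h : M.Ergodic) (s : S)
    {θ : ℝ} (hθ : 0 < θ) :
    ∃ p > 0, ∃ L : ℕ, ∀ F, IsSubMass F → θ ≤ F (dirac (some s)) →
      ∀ b : Option S → ℝ, 0 ≤ b → ∃ j ≤ L, p * mass b ≤ M.after F j b := by
  choose j δ hδ hle using fun σ => h.exists_mul_le_after σ s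
  set δ₀ := Finset.univ.inf' ⟨none, Finset.mem_univ _⟩ δ
  have hδ₀ : 0 < δ₀ := (Finset.lt_inf'_iff _).2 fun σ _ => hδ σ
  have hcard : (0 : ℝ) < Fintype.card (Option S) := Nat.cast_pos.2 Fintype.card_pos
  refine ⟨δ₀ * θ / Fintype.card (Option S), by positivity, ∑ σ, j σ, fun F hF hFθ b hb => ?_⟩
  obtain ⟨σ, -, hσ⟩ := Finset.exists_max_image Finset.univ b ⟨none, Finset.mem_univ _⟩
  refine ⟨j σ, Finset.single_le_sum (f := j) (fun _ _ => Nat.zero_le _) (Finset.mem_univ σ), ?_⟩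
  refine le_trans ?_ ((M.isSubMass_after hF (j σ)).mul_dirac_le hb σ)
  have h1 : mass b ≤ Fintype.card (Option S) * b σ := by
    have := Finset.sum_le_card_nsmul Finset.univ b (b σ) fun τ _ => hσ τ (Finset.mem_univ τ)
    rwa [nsmul_eq_mul] at this
  have h2 : δ₀ * θ ≤ M.after F (j σ) (dirac σ) :=
    le_trans (mul_le_mul (Finset.inf'_le _ (Finset.mem_univ σ)) hFθ hθ.le (hδ σ).le)
      (hle σ F hF)
  calc _ = (mass b / Fintype.card (Option S)) * (δ₀ * θ) := by ring
    _ ≤ b σ * (δ₀ * θ) := by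
      refine mul_le_mul_of_nonneg_right ?_ (by positivity)
      rw [div_le_iff₀ hcard]
      linarith
    _ ≤ _ := mul_le_mul_of_nonneg_left h2 (hb σ)

end Reachability

section Value

variable {Y O : Type} [Fintype Y] [Fintype O] {rmax : ℕ} {S : Type} [Fintype S]
  {ν : Environment Y O rmax}

/-- The average rewards `c` such that from some state the reward surplus over `c` can be kept
nonnegative forever with positive probability. -/
def POMDPOn.sustainable (M : POMDPOn S ν) : Set ℝ :=
  {c | 0 ≤ c ∧ ∃ s : S, ∃ θ > 0, ∀ K, θ ≤ M.survive c K 0 (dirac (some s))}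

lemma POMDPOn.zero_mem_sustainable (M : POMDPOn S ν) [Nonempty Y] : 0 ∈ M.sustainable := by
  obtain ⟨s, -, -⟩ := Finset.exists_ne_zero_of_sum_ne_zero (M.init_sum_one.trans_ne one_ne_zero)
  refine ⟨le_rfl, s, 1, one_pos, fun K => ?_⟩
  have := M.mass_le_survive_zero K le_rfl (dirac_nonneg (some s))
  rwa [mass_dirac] at this

lemma POMDPOn.le_of_mem_sustainable (M : POMDPOn S ν) [Nonempty Y] {c : ℝ}
    (hc : c ∈ M.sustainable) : c ≤ rmax := by
  by_contra! h
  obtain ⟨-, s, θ, hθ, hK⟩ := hc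
  exact absurd (hK 1) (not_le.2 ((M.survive_one_eq_zero h _).trans_lt hθ))

lemma POMDPOn.survive_le_of_notMem_sustainable (M : POMDPOn S ν) [Nonempty Y] {c : ℝ}
    (hc : 0 ≤ c) (h : c ∉ M.sustainable) {δ : ℝ} (hδ : 0 < δ) :
    ∃ K, ∀ s, M.survive c K 0 (dirac (some s)) ≤ δ := by
  have h1 : ∀ s, ∃ K, M.survive c K 0 (dirac (some s)) ≤ δ := by
    intro s
    by_contra! hcon
    exact h ⟨hc, s, δ, hδ, fun K => (hcon K).le⟩
  choose K hK using h1
  exact ⟨∑ s, K s, fun s => (M.survive_antitone c 0 (dirac_nonneg _)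
    (Finset.single_le_sum (fun _ _ => Nat.zero_le _) (Finset.mem_univ s))).trans (hK s)⟩

lemma POMDPOn.Ergodic.exists_value_bounds {M : POMDPOn S ν} [Nonempty Y] (h : M.Ergodic) :
    ∃ V : ℝ, V ∈ Set.Icc (0 : ℝ) (rmax : ℝ) ∧
      (∃ e ψ : ℕ → ℝ, Tendsto (fun n : ℕ => e n / n) atTop (nhds 0) ∧ Summable ψ ∧
        (∀ n, 0 ≤ ψ n) ∧
        ∀ b : Option S → ℝ, 0 ≤ b → ∃ q : Policy Y O rmax, ∀ n : ℕ,
          polSum n q (fun l => if e n < V * n - totalRew l then mass (M.filter b l) else 0)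
            ≤ ψ n * mass b) ∧
      ∀ v > V, ∃ lam > 0, ∃ A, ∀ (n : ℕ) (q : Policy Y O rmax) (b : Option S → ℝ), 0 ≤ b →
        polSum n q (fun l => Real.exp (lam * (totalRew l - v * n)) * mass (M.filter b l))
          ≤ A * mass b := by
  have hne : M.sustainable.Nonempty := ⟨0, M.zero_mem_sustainable⟩
  have hbdd : BddAbove M.sustainable := ⟨rmax, fun c hc => M.le_of_mem_sustainable hc⟩
  have hV0 : 0 ≤ sSup M.sustainable := le_csSup hbdd M.zero_mem_sustainable
  refine ⟨sSup M.sustainable, ⟨hV0, csSup_le hne fun c hc => M.le_of_mem_sustainable hc⟩,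
    M.exists_policy_lower fun J => ?_, fun v hv => ?_⟩
  · have hJ : (0 : ℝ) < 1 / ((J : ℝ) + 1) := by positivity
    obtain ⟨c, hc, hlt⟩ := exists_lt_of_lt_csSup hne (sub_lt_self (sSup M.sustainable) hJ)
    have hcR := M.le_of_mem_sustainable hc
    obtain ⟨-, s, θ, hθ, hK⟩ := hc
    obtain ⟨p, hp, L, hreach⟩ := h.exists_reach s hθ
    have hε : 0 < c - sSup M.sustainable + 2 / ((J : ℝ) + 1) := by
      have : 2 / ((J : ℝ) + 1) = 1 / ((J : ℝ) + 1) + 1 / ((J : ℝ) + 1) := by ring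
      linarith
    have := M.exists_potential hcR hp (fun K b hb =>
      hreach _ (M.isSubMass_survive c K 0) (hK K) b hb) hε
    simpa only [show c - (c - sSup M.sustainable + 2 / ((J : ℝ) + 1)) =
      sSup M.sustainable - 2 / ((J : ℝ) + 1) by ring] using this
  · have hmid : sSup M.sustainable < (sSup M.sustainable + v) / 2 := by linarith
    refine M.exists_exp_le (c := (sSup M.sustainable + v) / 2) (by linarith) (by linarith) ?_
    exact fun δ hδ => M.survive_le_of_notMem_sustainable (by linarith)
      (fun hmem => hmid.not_ge (le_csSup hbdd hmem)) hδ

end Value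

section Cylinders

variable {α : Type} [MeasurableSpace α] [MeasurableSingletonClass α]

lemma measurableSet_cylSet (l : List α) : MeasurableSet (cylSet l) := by
  have : cylSet l = ⋂ i : Fin l.length, (fun ω : ℕ → α => ω i.1) ⁻¹' {l.get i} := by
    ext ω
    simp [cylSet]
  rw [this]
  exact MeasurableSet.iInter fun i => measurable_pi_apply _ (measurableSet_singleton _)

lemma iUnion_cylSet_eq {α : Type} (n : ℕ) (P : List α → Prop) :
    ⋃ l : {l : List α // l.length = n ∧ P l}, cylSet l.1 = {ω | P (seg ω 0 n)} := by
  ext ω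
  simp only [Set.mem_iUnion, mem_cylSet_iff]
  constructor
  · rintro ⟨⟨l, hl, hP⟩, h⟩
    simp only [hl] at h
    rwa [Set.mem_ofPred_eq, h]
  · exact fun h => ⟨⟨seg ω 0 n, length_seg ω 0 n, h⟩, by simp⟩

lemma pairwise_disjoint_cylSet {α : Type} (n : ℕ) (P : List α → Prop) :
    Pairwise (Function.onFun Disjoint fun l : {l : List α // l.length = n ∧ P l} =>
      cylSet l.1) := by
  refine fun l l' hne => Set.disjoint_left.2 fun ω h h' => hne (Subtype.ext ?_)
  rw [mem_cylSet_iff, l.2.1] at h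
  rw [mem_cylSet_iff, l'.2.1] at h'
  exact h.symm.trans h'

lemma measurableSet_seg [Countable α] (n : ℕ) (P : List α → Prop) :
    MeasurableSet {ω : ℕ → α | P (seg ω 0 n)} := by
  rw [← iUnion_cylSet_eq]
  exact MeasurableSet.iUnion fun l => measurableSet_cylSet _

lemma measure_seg_next [Countable α] (μ : Measure (ℕ → α)) (n : ℕ) (P : List α → Prop) (z : α)
    (c : ℝ≥0∞) (h : ∀ l, l.length = n → P l → μ (cylSet (l ++ [z])) = μ (cylSet l) * c) :
    μ {ω | P (seg ω 0 n) ∧ ω n = z} = μ {ω | P (seg ω 0 n)} * c := by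
  have h1 : {ω : ℕ → α | P (seg ω 0 n) ∧ ω n = z} =
      ⋃ l : {l : List α // l.length = n ∧ P l}, cylSet (l.1 ++ [z]) := by
    have : ∀ l : {l : List α // l.length = n ∧ P l},
        cylSet (l.1 ++ [z]) = cylSet l.1 ∩ {ω | ω n = z} := by
      intro l
      ext ω
      rw [mem_cylSet_append_singleton, l.2.1]
      rfl
    simp_rw [this]
    rw [← Set.iUnion_inter, iUnion_cylSet_eq]
    rfl
  rw [h1, ← iUnion_cylSet_eq, measure_iUnion _ fun l => measurableSet_cylSet _,
    measure_iUnion (pairwise_disjoint_cylSet n P) fun l => measurableSet_cylSet _,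
    ← ENNReal.tsum_mul_right]
  · exact tsum_congr fun l => h _ l.2.1 l.2.2
  · refine fun l l' hne => (pairwise_disjoint_cylSet n P hne).mono ?_ ?_
    all_goals exact fun ω hω => (mem_cylSet_append_singleton.1 hω).1

end Cylinders

section MeasureLink

variable {Y O : Type} [Fintype Y] [Fintype O] {rmax : ℕ} {S : Type} [Fintype S]
  {ν : Environment Y O rmax}

instance (Y O : Type) (rmax : ℕ) : MeasurableSingletonClass (Cycle Y O rmax) := ⟨fun _ => trivial⟩

instance (S Y O : Type) (rmax : ℕ) : MeasurableSingletonClass (S × Cycle Y O rmax) :=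
  ⟨fun _ => trivial⟩

/-- The actions of the history `h` are those chosen by the policy `p`. -/
def Consistent {Y O : Type} {rmax : ℕ} (p : Policy Y O rmax) (h : List (Cycle Y O rmax)) : Prop :=
  ∀ l z, l ++ [z] <+: h → z.1 = p l

lemma consistent_nil {Y O : Type} {rmax : ℕ} (p : Policy Y O rmax) : Consistent p [] := by
  intro l z h
  simp at h

lemma consistent_append_singleton {Y O : Type} {rmax : ℕ} {p : Policy Y O rmax}
    {h : List (Cycle Y O rmax)} {z : Cycle Y O rmax} :
    Consistent p (h ++ [z]) ↔ Consistent p h ∧ z.1 = p h := by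
  constructor
  · exact fun hc => ⟨fun l z' hl => hc l z' (hl.trans (List.prefix_append _ _)),
      hc h z List.prefix_rfl⟩
  · rintro ⟨hc, hz⟩ l z' hl
    rcases List.prefix_concat_iff.1 hl with h1 | h1
    · obtain ⟨rfl, h2⟩ := List.append_inj' h1 rfl
      obtain rfl : z' = z := by simpa using h2
      exact hz
    · exact hc l z' h1

lemma consistent_replacePolicy {Y O : Type} {rmax : ℕ} (h : List (Cycle Y O rmax))
    (p : Policy Y O rmax) : Consistent (replacePolicy h p) h := by
  rintro l z ⟨t, rfl⟩
  rw [replacePolicy, dif_pos (by simp)]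
  simp

lemma replacePolicy_append {Y O : Type} {rmax : ℕ} (h : List (Cycle Y O rmax))
    (p : Policy Y O rmax) (l : List (Cycle Y O rmax)) :
    replacePolicy h p (h ++ l) = p (h ++ l) := by
  rw [replacePolicy, dif_neg (by simp)]

lemma seg_map {α β : Type} (f : α → β) (ω : ℕ → α) (k n : ℕ) :
    seg (fun i => f (ω i)) k n = (seg ω k n).map f :=
  List.ext_getElem (by simp) fun i h₁ h₂ => by simp

lemma POMDPOn.Pjoint_filter (M : POMDPOn S ν) (p : Policy Y O rmax) {h : List (Cycle Y O rmax)}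
    (hc : Consistent p h) (σ : Option S) :
    M.Pjoint p {ω | (seg ω 0 h.length).map Prod.snd = h ∧ lastState (seg ω 0 h.length) = σ}
      = ENNReal.ofReal (M.filter (dirac none) h σ) := by
  induction h using List.reverseRecOn generalizing σ with
  | nil =>
    have := M.Pjoint_prob p
    cases σ with
    | none => simp [lastState, dirac]
    | some s => simp [lastState, dirac]
  | append_singleton h z ih =>
    obtain ⟨hc', hz⟩ := consistent_append_singleton.1 hc
    rw [List.length_append, List.length_singleton, M.filter_append, M.filter_cons, M.filter_nil]
    simp only [lastState_seg_succ]
    simp only [seg_succ_last, List.map_append, zero_add]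
    cases σ with
    | none => simp [M.step_none]
    | some s =>
      have h1 : {ω : ℕ → S × Cycle Y O rmax |
          List.map Prod.snd (seg ω 0 h.length) ++ List.map Prod.snd [ω h.length] = h ++ [z] ∧
            some (ω h.length).1 = some s} =
          ⋃ τ : Option S, {ω | ((seg ω 0 h.length).map Prod.snd = h ∧
            lastState (seg ω 0 h.length) = τ) ∧ ω h.length = (s, z)} := by
        ext ω
        simp only [Set.mem_ofPred_eq, Set.mem_iUnion, Option.some.injEq, Prod.ext_iff,
          List.map_cons, List.map_nil]
        constructor
        · rintro ⟨h2, h3⟩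
          obtain ⟨h4, h5⟩ := List.append_inj' h2 rfl
          have h5 := (List.cons.inj h5).1
          exact ⟨_, ⟨h4, rfl⟩, h3, by simp [h5]⟩
        · rintro ⟨τ, ⟨h2, -⟩, h3, h4, h5⟩
          refine ⟨?_, h3⟩
          rw [h2, show (ω h.length).2 = z from Prod.ext h4 (Prod.ext h5.1 h5.2)]
      rw [h1, measure_iUnion, tsum_fintype]
      · have h2 : ∀ τ : Option S, M.Pjoint p {ω | ((seg ω 0 h.length).map Prod.snd = h ∧
            lastState (seg ω 0 h.length) = τ) ∧ ω h.length = (s, z)} =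
            ENNReal.ofReal (M.filter (dirac none) h τ * M.tr τ z.1 s * M.emit s z.1 z.2) := by
          intro τ
          rw [measure_seg_next (M.Pjoint p) h.length
            (fun l => l.map Prod.snd = h ∧ lastState l = τ) (s, z)
            (ENNReal.ofReal (M.tr τ z.1 s * M.emit s z.1 z.2)), ih hc',
            ← ENNReal.ofReal_mul (M.filter_nonneg (dirac_nonneg _) h τ), mul_assoc]
          rintro l hl ⟨h3, h4⟩
          rw [M.Pjoint_cyl_append, h3, h4, if_pos hz]
        rw [Finset.sum_congr rfl fun τ _ => h2 τ, ← ENNReal.ofReal_sum_of_nonneg,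
          ← Finset.sum_mul]
        · rfl
        · exact fun τ _ => mul_nonneg (mul_nonneg (M.filter_nonneg (dirac_nonneg _) h τ)
            (M.tr_nonneg _ _ _)) (M.emit_nonneg _ _ _)
      · refine fun τ τ' hne => Set.disjoint_left.2 fun ω h2 h3 => hne ?_
        exact h2.1.2.symm.trans h3.1.2
      · intro τ
        refine MeasurableSet.inter (measurableSet_seg h.length
          (fun l => l.map Prod.snd = h ∧ lastState l = τ)) ?_
        exact (measurable_pi_apply (X := fun _ : ℕ => S × Cycle Y O rmax) h.length)
          (measurableSet_singleton (s, z))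

lemma POMDPOn.P_cylSet (M : POMDPOn S ν) (p : Policy Y O rmax) {h : List (Cycle Y O rmax)}
    (hc : Consistent p h) :
    ν.P p (cylSet h) = ENNReal.ofReal (mass (M.filter (dirac none) h)) := by
  have hmeas : Measurable fun (ω : ℕ → S × Cycle Y O rmax) i => (ω i).2 :=
    measurable_pi_lambda _ fun i => Measurable.comp (g := Prod.snd) measurable_from_top
      (measurable_pi_apply i)
  rw [← M.marginal, Measure.map_apply hmeas (measurableSet_cylSet h)]
  have h1 : (fun (ω : ℕ → S × Cycle Y O rmax) i => (ω i).2) ⁻¹' cylSet h =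
      ⋃ τ : Option S, {ω | (seg ω 0 h.length).map Prod.snd = h ∧
        lastState (seg ω 0 h.length) = τ} := by
    ext ω
    rw [Set.mem_preimage, mem_cylSet_iff, seg_map]
    simp
  rw [h1, measure_iUnion, tsum_fintype, Finset.sum_congr rfl fun τ _ => M.Pjoint_filter p hc τ,
    ← ENNReal.ofReal_sum_of_nonneg fun τ _ => M.filter_nonneg (dirac_nonneg _) h τ]
  · rfl
  · exact fun τ τ' hne => Set.disjoint_left.2 fun ω h2 h3 => hne (h2.2.symm.trans h3.2)
  · exact fun τ => measurableSet_seg h.length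
      (fun l => l.map Prod.snd = h ∧ lastState l = τ)

lemma POMDPOn.P_cylSet_inter_le (M : POMDPOn S ν) (p : Policy Y O rmax)
    {h : List (Cycle Y O rmax)} (hc : Consistent p h) (n : ℕ)
    (F : List (Cycle Y O rmax) → Prop) :
    ν.P p (cylSet h ∩ {ω | F (seg ω h.length n)}) ≤
      ENNReal.ofReal (polSum n (fun l => p (h ++ l)) fun l =>
        if F l then mass (M.filter (dirac none) (h ++ l)) else 0) := by
  induction n generalizing h F with
  | zero =>
    simp only [polSum, seg_zero, List.append_nil]
    split_ifs with hF
    · exact (measure_mono Set.inter_subset_left).trans (M.P_cylSet p hc).le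
    · simp [hF]
  | succ n ih =>
    have h1 : cylSet h ∩ {ω : Traj Y O rmax | F (seg ω h.length (n + 1))} ⊆
        (⋃ x : Percept O rmax, cylSet (h ++ [(p h, x)]) ∩
          {ω | F ((p h, x) :: seg ω (h ++ [(p h, x)]).length n)}) ∪
        ⋃ z : {z : Cycle Y O rmax // z.1 ≠ p h}, cylSet (h ++ [z.1]) := by
      rintro ω ⟨hω, hF⟩
      rw [Set.mem_ofPred_eq, seg_succ] at hF
      by_cases hz : (ω h.length).1 = p h
      · refine Or.inl (Set.mem_iUnion.2 ⟨(ω h.length).2, ?_, ?_⟩)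
        · exact mem_cylSet_append_singleton.2 ⟨hω, Prod.ext hz rfl⟩
        · rw [Set.mem_ofPred_eq, ← hz, List.length_append]
          exact hF
      · exact Or.inr (Set.mem_iUnion.2 ⟨⟨ω h.length, hz⟩,
          mem_cylSet_append_singleton.2 ⟨hω, rfl⟩⟩)
    have h2 : ν.P p (⋃ z : {z : Cycle Y O rmax // z.1 ≠ p h}, cylSet (h ++ [z.1])) = 0 := by
      refine measure_iUnion_null fun z => ?_
      rw [ν.P_cyl, if_neg z.2, ENNReal.ofReal_zero, mul_zero]
    refine (measure_mono h1).trans ((measure_union_le _ _).trans ?_)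
    rw [h2, add_zero]
    refine (measure_iUnion_fintype_le _ _).trans ?_
    have hnn : ∀ x : Percept O rmax, 0 ≤ polSum n (fun l => p (h ++ (p h, x) :: l)) fun l =>
        if F ((p h, x) :: l) then mass (M.filter (dirac none) (h ++ (p h, x) :: l)) else 0 := by
      intro x
      have h0 := polSum_const_mul n (fun l => p (h ++ (p h, x) :: l)) 0 fun _ => 0
      simp only [mul_zero, zero_mul] at h0
      refine h0.ge.trans (polSum_mono fun l _ => ?_)
      split_ifs
      · exact mass_nonneg (M.filter_nonneg (dirac_nonneg _) _)
      · rfl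
    simp only [polSum, List.append_nil]
    rw [ENNReal.ofReal_sum_of_nonneg fun x _ => hnn x]
    refine Finset.sum_le_sum fun x _ => ?_
    have := ih (h := h ++ [(p h, x)]) (consistent_append_singleton.2 ⟨hc, rfl⟩)
      fun l => F ((p h, x) :: l)
    simpa only [List.append_assoc, List.singleton_append] using this

end MeasureLink

section Conclusion

variable {Y O : Type} [Fintype Y] [Fintype O] {rmax : ℕ} {S : Type} [Fintype S]
  {ν : Environment Y O rmax}

lemma totalRew_seg {Y O : Type} {rmax : ℕ} (ω : Traj Y O rmax) (k n : ℕ) :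
    totalRew (seg ω k n) = ∑ i ∈ Finset.range n, rew (ω (k + i)) := by
  induction n with
  | zero => simp
  | succ n ih => rw [seg_succ_last, totalRew_append, ih, Finset.sum_range_succ]; simp

lemma avg_eq {Y O : Type} {rmax : ℕ} (ω : Traj Y O rmax) (n : ℕ) :
    avg ω n = totalRew (seg ω 0 n) / n := by
  simp [avg, totalRew_seg]

lemma avg_mem_Icc {Y O : Type} {rmax : ℕ} (ω : Traj Y O rmax) (n : ℕ) :
    avg ω n ∈ Set.Icc (0 : ℝ) rmax := by
  rw [avg_eq]
  refine ⟨div_nonneg (totalRew_nonneg _) n.cast_nonneg, div_le_of_le_mul₀ n.cast_nonneg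
    rmax.cast_nonneg ?_⟩
  simpa using totalRew_le (seg ω 0 n)

lemma POMDPOn.P_le_ofReal_polSum (M : POMDPOn S ν) (p : Policy Y O rmax) (n : ℕ)
    (F : List (Cycle Y O rmax) → Prop) :
    ν.P p {ω | F (seg ω 0 n)} ≤ ENNReal.ofReal (polSum n p fun l =>
      if F l then mass (M.filter (dirac none) l) else 0) := by
  have h := M.P_cylSet_inter_le p (consistent_nil p) n F
  have h0 : cylSet ([] : List (Cycle Y O rmax)) = Set.univ := by
    ext ω
    simp [mem_cylSet_iff]
  rwa [h0, Set.univ_inter] at h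

lemma ae_eventually_not_of_summable {Ω : Type} [MeasurableSpace Ω] {μ : Measure Ω}
    {A : ℕ → Ω → Prop} {c : ℕ → ℝ} (hc : Summable c)
    (h : ∀ n, μ {ω | A n ω} ≤ ENNReal.ofReal (c n)) :
    ∀ᵐ ω ∂μ, ∀ᶠ n in atTop, ¬ A n ω :=
  ae_eventually_notMem (s := fun n => {ω | A n ω})
    (((ENNReal.tsum_le_tsum h).trans_lt hc.tsum_ofReal_lt_top).ne)

lemma POMDPOn.ae_eventually_avg_le (M : POMDPOn S ν) {v v' lam A : ℝ} (hv : v < v')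
    (hlam : 0 < lam) (q : Policy Y O rmax)
    (h : ∀ n : ℕ, polSum n q (fun l => Real.exp (lam * (totalRew l - v * n)) *
      mass (M.filter (dirac none) l)) ≤ A) :
    ∀ᵐ ω ∂ν.P q, ∀ᶠ n in atTop, avg ω n ≤ v' := by
  have hr : Real.exp (-(lam * (v' - v))) < 1 :=
    Real.exp_lt_one_iff.2 (neg_neg_of_pos (mul_pos hlam (sub_pos.2 hv)))
  have hs : Summable fun n : ℕ => Real.exp (-(lam * (v' - v))) ^ n * A :=
    (summable_geometric_of_lt_one (Real.exp_pos _).le hr).mul_right A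
  have hae := ae_eventually_not_of_summable (μ := ν.P q)
    (A := fun n ω => v' * n < totalRew (seg ω 0 n)) hs fun n => by
      refine (M.P_le_ofReal_polSum q n fun l => v' * n < totalRew l).trans
        (ENNReal.ofReal_le_ofReal ?_)
      refine le_trans ?_ (mul_le_mul_of_nonneg_left (h n) (pow_nonneg (Real.exp_pos _).le n))
      rw [← polSum_const_mul]
      refine polSum_mono fun l _ => ?_
      have hm := mass_nonneg (M.filter_nonneg (dirac_nonneg none) l)
      rw [← mul_assoc, ← Real.exp_nat_mul, ← Real.exp_add]
      split_ifs with hl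
      · refine le_mul_of_one_le_left hm (Real.one_le_exp ?_)
        have := mul_nonneg hlam.le (sub_pos.2 hl).le
        linarith
      · positivity
  filter_upwards [hae] with ω hω
  filter_upwards [hω, eventually_gt_atTop 0] with n hn hn0
  rw [avg_eq, div_le_iff₀ (by exact_mod_cast hn0)]
  exact not_lt.1 hn

lemma isBoundedUnder_avg_le {Y O : Type} {rmax : ℕ} (ω : Traj Y O rmax) :
    IsBoundedUnder (· ≤ ·) atTop (avg ω) :=
  isBoundedUnder_of ⟨rmax, fun n => (avg_mem_Icc ω n).2⟩

lemma isCoboundedUnder_avg_le {Y O : Type} {rmax : ℕ} (ω : Traj Y O rmax) :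
    IsCoboundedUnder (· ≤ ·) atTop (avg ω) :=
  (isBoundedUnder_of ⟨0, fun n => (avg_mem_Icc ω n).1⟩ :
    IsBoundedUnder (· ≥ ·) atTop (avg ω)).isCoboundedUnder_le

lemma tendsto_avg {Y O : Type} {rmax : ℕ} {ω : Traj Y O rmax} {V : ℝ} {e : ℕ → ℝ}
    (he : Tendsto (fun n : ℕ => e n / n) atTop (nhds 0))
    (hlow : ∀ᶠ n : ℕ in atTop, V * n - totalRew (seg ω 0 n) ≤ e n)
    (hup : limsup (avg ω) atTop ≤ V) : Tendsto (avg ω) atTop (nhds V) := by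
  rw [tendsto_order]
  constructor
  · intro a ha
    have h := he.eventually_lt_const (sub_pos.2 ha)
    filter_upwards [h, hlow, eventually_gt_atTop 0] with n h1 h2 hn
    have hn : (0 : ℝ) < n := by exact_mod_cast hn
    rw [div_lt_iff₀ hn] at h1
    rw [avg_eq, lt_div_iff₀ hn]
    linarith
  · exact fun a ha => eventually_lt_of_limsup_lt (hup.trans_lt ha) (isBoundedUnder_avg_le ω)

lemma measure_eq_one_of_ae {Ω : Type} [MeasurableSpace Ω] {μ : Measure Ω}
    (hμ : IsProbabilityMeasure μ) {A : Ω → Prop} (h : ∀ᵐ ω ∂μ, A ω) : μ {ω | A ω} = 1 := by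
  rw [measure_congr (eventuallyEq_univ.2 h), measure_univ]

lemma POMDPOn.condProb_le (M : POMDPOn S ν) {h : List (Cycle Y O rmax)} {n : ℕ}
    {F : List (Cycle Y O rmax) → Prop} {q : Policy Y O rmax} {c : ℝ} (hc : 0 ≤ c)
    (hq : polSum n q (fun l => if F l then mass (M.filter (M.filter (dirac none) h) l) else 0)
      ≤ c * mass (M.filter (dirac none) h)) :
    condProb ν (fun l => q (l.drop h.length)) h {ω | F (seg ω h.length n)} ≤
      ENNReal.ofReal c := by
  set p : Policy Y O rmax := fun l => q (l.drop h.length)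
  have hp : (fun l => replacePolicy h p (h ++ l)) = q := by
    funext l
    simp [replacePolicy_append, p]
  have hcons := consistent_replacePolicy h p
  have h1 := M.P_cylSet_inter_le _ hcons n F
  rw [hp] at h1
  simp_rw [M.filter_append] at h1
  have h2 := h1.trans (ENNReal.ofReal_le_ofReal hq)
  rw [ENNReal.ofReal_mul hc, ← M.P_cylSet _ hcons] at h2
  rw [condProb, condMeasure, ProbabilityTheory.cond_apply (measurableSet_cylSet h)]
  calc _ ≤ (ν.P (replacePolicy h p) (cylSet h))⁻¹ *
        (ENNReal.ofReal c * ν.P (replacePolicy h p) (cylSet h)) := by gcongr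
    _ = ENNReal.ofReal c * (ν.P (replacePolicy h p) (cylSet h) *
        (ν.P (replacePolicy h p) (cylSet h))⁻¹) := by ring
    _ ≤ ENNReal.ofReal c * 1 := by gcongr; exact ENNReal.mul_inv_le_one _
    _ = ENNReal.ofReal c := mul_one _

lemma isOptimalValue_of_bounds (M : POMDPOn S ν) {V : ℝ} {e ψ : ℕ → ℝ}
    {q : Policy Y O rmax} (he : Tendsto (fun n : ℕ => e n / n) atTop (nhds 0)) (hψ : Summable ψ)
    (hq : ∀ n : ℕ, polSum n q (fun l => if e n < V * n - totalRew l then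
      mass (M.filter (dirac none) l) else 0) ≤ ψ n)
    (hup : ∀ v > V, ∃ lam > 0, ∃ A, ∀ (n : ℕ) (p : Policy Y O rmax),
      polSum n p (fun l => Real.exp (lam * (totalRew l - v * n)) *
        mass (M.filter (dirac none) l)) ≤ A) :
    IsOptimalValue ν V := by
  have hlimsup : ∀ p : Policy Y O rmax, ∀ᵐ ω ∂ν.P p, limsup (avg ω) atTop ≤ V := by
    intro p
    have h : ∀ k : ℕ, ∀ᵐ ω ∂ν.P p, ∀ᶠ n in atTop, avg ω n ≤ V + 2 * (1 / ((k : ℝ) + 1)) := by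
      intro k
      have hk : (0 : ℝ) < 1 / ((k : ℝ) + 1) := by positivity
      obtain ⟨lam, hlam, A, hA⟩ := hup (V + 1 / ((k : ℝ) + 1)) (by linarith)
      exact M.ae_eventually_avg_le (by linarith) hlam p fun n => hA n p
    filter_upwards [ae_all_iff.2 h] with ω hω
    have hlim : Tendsto (fun k : ℕ => V + 2 * (1 / ((k : ℝ) + 1))) atTop (nhds (V + 2 * 0)) :=
      (tendsto_one_div_add_atTop_nhds_zero_nat.const_mul 2).const_add V
    rw [mul_zero, add_zero] at hlim
    exact ge_of_tendsto' hlim fun k =>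
      limsup_le_of_le (isCoboundedUnder_avg_le ω) (hω k)
  refine ⟨q, measure_eq_one_of_ae (ν.P_prob q) ?_,
    fun p => measure_eq_one_of_ae (ν.P_prob p) (hlimsup p)⟩
  have hlow := ae_eventually_not_of_summable (μ := ν.P q)
    (A := fun n ω => e n < V * n - totalRew (seg ω 0 n)) hψ fun n =>
      (M.P_le_ofReal_polSum q n fun l => e n < V * n - totalRew l).trans
        (ENNReal.ofReal_le_ofReal (hq n))
  filter_upwards [hlow, hlimsup q] with ω h1 h2
  exact tendsto_avg he (h1.mono fun n hn => not_lt.1 hn) h2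

lemma POMDPOn.valueStableCore (M : POMDPOn S ν) {V : ℝ} (hV : V ∈ Set.Icc (0 : ℝ) rmax)
    {e ψ : ℕ → ℝ} (he : Tendsto (fun n : ℕ => e n / n) atTop (nhds 0)) (hψ : Summable ψ)
    (hψ0 : ∀ n, 0 ≤ ψ n)
    (hq : ∀ b : Option S → ℝ, 0 ≤ b → ∃ q : Policy Y O rmax, ∀ n : ℕ,
      polSum n q (fun l => if e n < V * n - totalRew l then mass (M.filter b l) else 0)
        ≤ ψ n * mass b) :
    ValueStableCore ν V (fun _ => V) (fun _ _ => 0)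
      fun n ε => if e (n + 1) ≤ n * ε then ψ (n + 1) else 1 := by
  refine ⟨fun _ => hV, ?_, fun _ _ => isLittleO_zero _ _, fun ε hε => ?_, fun h => ?_⟩
  · refine tendsto_const_nhds.congr' ?_
    filter_upwards [eventually_gt_atTop 0] with n hn
    have hn : (n : ℝ) ≠ 0 := by exact_mod_cast hn.ne'
    rw [Finset.sum_const, Finset.card_range, nsmul_eq_mul, mul_div_cancel_left₀ _ hn]
  · refine ((summable_nat_add_iff 1).2 hψ).congr_atTop ?_
    have h1 := ((tendsto_add_atTop_iff_nat 1).2 he).eventually_lt_const (half_pos hε)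
    filter_upwards [h1, eventually_ge_atTop 1] with n hn hn1
    have hn1 : (1 : ℝ) ≤ n := by exact_mod_cast hn1
    push_cast at hn
    rw [div_lt_iff₀ (by positivity)] at hn
    rw [if_pos]
    nlinarith
  · obtain ⟨q, hq⟩ := hq _ (M.filter_nonneg (dirac_nonneg none) h)
    refine ⟨fun l => q (l.drop h.length), fun ε _ n => ?_⟩
    by_cases hn : e (n + 1) ≤ n * ε
    · simp only [if_pos hn, zero_add]
      refine le_trans (measure_mono ?_) (M.condProb_le (hψ0 (n + 1)) (hq (n + 1)))
      intro ω hω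
      have hI (f : ℕ → ℝ) : ∑ i ∈ Finset.Icc h.length (h.length + n), f i =
          ∑ i ∈ Finset.range (n + 1), f (h.length + i) := by
        rw [← Finset.Ico_add_one_right_eq_Icc, Finset.sum_Ico_eq_sum_range]
        congr 2
        omega
      rw [Set.mem_ofPred_eq, hI, hI, ← totalRew_seg, Finset.sum_const, Finset.card_range,
        nsmul_eq_mul] at hω
      rw [Set.mem_ofPred_eq]
      linarith
    · simp only [if_neg hn, ENNReal.ofReal_one]
      exact prob_le_one (μ := ProbabilityTheory.cond _ _)

end Conclusion

/-- **Corollary (POMDP ⇒ value-stable).**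
Suppose a POMDP `ν` is ergodic and there exists a set `H ⊆ R` of rewards such that
`ν(r_i ∈ H) = 1` and `ν(r_i = r | s_i = s, y_i = y) ≠ 0` for every action `y`, every
state `s` and every `r ∈ H`.  Then `ν` is value-stable. -/
theorem ergodicPOMDP_valueStable {Y O : Type} [Fintype Y] [Fintype O]
    [Nonempty Y] [Nonempty O] {rmax : ℕ}
    (ν : Environment Y O rmax) (S : Type) [Fintype S]
    (M : POMDPOn S ν) (herg : M.Ergodic)
    (H : Set (Fin (rmax + 1)))
    (hH1 : ∀ (p : Policy Y O rmax) (i : ℕ), ν.P p {ω | (ω i).2.1 ∈ H} = 1)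
    (hH2 : ∀ (s : S) (y : Y) (r : Fin (rmax + 1)), r ∈ H →
      (∑ o : O, M.emit s y (r, o)) ≠ 0) :
    ValueStable ν := by
  obtain ⟨V, hV, ⟨e, ψ, he, hψ, hψ0, hlow⟩, hup⟩ := herg.exists_value_bounds
  refine ⟨V, _, _, _, ?_, M.valueStableCore hV he hψ hψ0 hlow⟩
  obtain ⟨q, hq⟩ := hlow _ (dirac_nonneg none)
  simp only [mass_dirac, mul_one] at hq
  refine isOptimalValue_of_bounds M he hψ hq fun v hv => ?_
  obtain ⟨lam, hlam, A, hA⟩ := hup v hv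
  refine ⟨lam, hlam, A, fun n p => ?_⟩
  simpa only [mass_dirac, mul_one] using hA n p _ (dirac_nonneg none)

end RL
end
end

section
/- There exists a countable family C of deterministic explorable environments such that: (1) for every ν ∈ C and every finite sequence of actions y_{<k} there exists a policy p with r^ν_{k..k+n} ≤ r^{pν}_{k..k+n} + k for all n ≥ k, where r_i^ν are the rewards attained by an optimal policy p_ν which acted optimally from the beginning; but (2) for every policy p there exists an environment ν ∈ C with V̲(ν,p) < V*_ν; in particular, there is no self-optimizing policy for C. -/
open MeasureTheory Filter Finset Asymptotics
open scoped ENNReal Classical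

noncomputable section

namespace RL

section DeterministicEnvironment

variable {Y O : Type} {rmax : ℕ}

/-- The history generated by the policy `p` when perceptions are given by `f`. -/
def genHist (f : List (Cycle Y O rmax) → Y → Percept O rmax) (p : Policy Y O rmax) :
    ℕ → List (Cycle Y O rmax)
  | 0 => []
  | n + 1 => genHist f p n ++ [(p (genHist f p n), f (genHist f p n) (p (genHist f p n)))]

/-- The trajectory generated by the policy `p` when perceptions are given by `f`. -/
def genTraj (f : List (Cycle Y O rmax) → Y → Percept O rmax) (p : Policy Y O rmax) :
    Traj Y O rmax :=
  fun n => (p (genHist f p n), f (genHist f p n) (p (genHist f p n)))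

theorem genHist_eq_map_range (f : List (Cycle Y O rmax) → Y → Percept O rmax)
    (p : Policy Y O rmax) (n : ℕ) : genHist f p n = (List.range n).map (genTraj f p) := by
  induction n with
  | zero => rfl
  | succ n ih =>
    rw [List.range_succ, List.map_append, ← ih]
    rfl

theorem mem_cylSet_iff_s11 {A : Type} (ω : ℕ → A) (l : List A) :
    ω ∈ cylSet l ↔ (List.range l.length).map ω = l := by
  simp only [cylSet, Set.mem_ofPred_eq]
  constructor
  · intro h
    apply List.ext_getElem
    · simp
    · intro i h₁ h₂
      simpa using h ⟨i, h₂⟩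
  · intro h i
    have h₂ : ((List.range l.length).map ω)[i.1]? = l[i.1]? := by rw [h]
    simpa using h₂

instance : MeasurableSingletonClass (Cycle Y O rmax) := ⟨fun _ => trivial⟩

variable [Fintype Y] [Fintype O]

/-- The deterministic environment whose perceptions are given by `f`. -/
def detEnv (f : List (Cycle Y O rmax) → Y → Percept O rmax) : Environment Y O rmax where
  cond h y x := if x = f h y then 1 else 0
  cond_nonneg h y x := by split_ifs <;> norm_num
  cond_sum_one h y := by simp
  P p := Measure.dirac (genTraj f p)
  P_prob p := inferInstance
  P_cyl p h z := by
    have key : genTraj f p ∈ cylSet (h ++ [z]) ↔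
        genTraj f p ∈ cylSet h ∧ z.1 = p h ∧ z.2 = f h z.1 := by
      simp only [mem_cylSet_iff_s11, List.length_append, List.length_singleton, List.range_succ,
        List.map_append, List.map_cons, List.map_nil]
      refine Iff.trans ⟨fun hh => List.append_inj hh (by simp), fun hh => by rw [hh.1, hh.2]⟩ ?_
      refine and_congr_right fun hh => ?_
      rw [← genHist_eq_map_range] at hh
      simp only [List.cons.injEq, and_true, genTraj, hh, Prod.ext_iff (y := z)]
      constructor
      · rintro ⟨h₁, h₂⟩
        exact ⟨h₁.symm, by rw [← h₁]; exact h₂.symm⟩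
      · rintro ⟨h₁, h₂⟩
        rw [← h₁, ← h₂]
        exact ⟨rfl, rfl⟩
    rw [Measure.dirac_apply, Measure.dirac_apply, Set.indicator_apply, Set.indicator_apply]
    by_cases h₁ : genTraj f p ∈ cylSet h <;> by_cases h₂ : z.1 = p h <;>
      by_cases h₃ : z.2 = f h z.1 <;> simp [key, h₁, h₂, h₃]
    all_goals simp_all

variable (f : List (Cycle Y O rmax) → Y → Percept O rmax)

theorem deterministic_detEnv : Deterministic (detEnv f) := by
  intro h y x
  simp only [detEnv]
  split_ifs <;> simp

theorem pick_detEnv [Nonempty O] (h : List (Cycle Y O rmax)) (y : Y) :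
    pick (detEnv f) h y = f h y := by
  have hx : ∃ x, (detEnv f).cond h y x = 1 := ⟨f h y, by simp [detEnv]⟩
  rw [pick, dif_pos hx]
  by_contra hne
  have h₁ : (if hx.choose = f h y then (1 : ℝ) else 0) = 1 := hx.choose_spec
  rw [if_neg hne] at h₁
  exact zero_ne_one h₁

theorem detHist_detEnv [Nonempty O] (p : Policy Y O rmax) (n : ℕ) :
    detHist (detEnv f) p n = genHist f p n := by
  induction n with
  | zero => rfl
  | succ n ih => simp only [detHist, genHist, ih, pick_detEnv]

theorem detZ_detEnv [Nonempty O] (p : Policy Y O rmax) :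
    detZ (detEnv f) p = genTraj f p := by
  funext n
  simp only [detZ, genTraj, detHist_detEnv, pick_detEnv]

theorem detEnv_P_eq_one_iff (p : Policy Y O rmax) (s : Set (Traj Y O rmax)) :
    (detEnv f).P p s = 1 ↔ genTraj f p ∈ s := by
  change Measure.dirac (genTraj f p) s = 1 ↔ _
  rw [Measure.dirac_apply, Set.indicator_apply]
  split_ifs with h <;> simp [h]

end DeterministicEnvironment

section Average

variable {Y O : Type} {rmax : ℕ}

theorem rew_nonneg (z : Cycle Y O rmax) : 0 ≤ rew z := Nat.cast_nonneg _

theorem rew_le (z : Cycle Y O rmax) : rew z ≤ rmax := by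
  unfold rew
  exact_mod_cast Nat.lt_succ_iff.mp z.2.1.2

theorem avg_nonneg (ω : Traj Y O rmax) (m : ℕ) : 0 ≤ avg ω m :=
  div_nonneg (Finset.sum_nonneg fun _ _ => rew_nonneg _) (Nat.cast_nonneg _)

theorem avg_le {ω : Traj Y O rmax} {c : ℝ} (hc : 0 ≤ c) (h : ∀ i, rew (ω i) ≤ c) (m : ℕ) :
    avg ω m ≤ c := by
  refine div_le_of_le_mul₀ (Nat.cast_nonneg _) hc ?_
  calc ∑ i ∈ Finset.range m, rew (ω i) ≤ ∑ i ∈ Finset.range m, c :=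
        Finset.sum_le_sum fun i _ => h i
    _ = c * m := by simp [mul_comm]

theorem limsup_avg_le {ω : Traj Y O rmax} {c : ℝ} (hc : 0 ≤ c) (h : ∀ i, rew (ω i) ≤ c) :
    limsup (avg ω) atTop ≤ c :=
  limsup_le_of_le (isCoboundedUnder_le_of_le atTop (avg_nonneg ω))
    (Eventually.of_forall (avg_le hc h))

theorem liminf_avg_le_of_frequently {ω : Traj Y O rmax} {c : ℝ}
    (h : ∃ᶠ m in atTop, avg ω m ≤ c) : liminf (avg ω) atTop ≤ c :=
  liminf_le_of_frequently_le h (isBoundedUnder_of ⟨0, avg_nonneg ω⟩)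

theorem tendsto_avg_of_eventually_eq {ω : Traj Y O rmax} {c : ℝ}
    (h : ∀ᶠ i in atTop, rew (ω i) = c) : Tendsto (avg ω) atTop (nhds c) := by
  have h₁ : Tendsto (fun i => rew (ω i)) atTop (nhds c) :=
    tendsto_const_nhds.congr' (h.mono fun i hi => hi.symm)
  refine h₁.cesaro.congr fun n => ?_
  rw [avg, div_eq_inv_mul]

end Average

section LockEnvironment

/-- Reward `2` whatever the action once the actions so far satisfy `u`; before that,
action `true` yields `0` and action `false` yields `1`. -/
def lockPercept (u : List Bool → Prop) (h : List (Cycle Bool Unit 2)) (y : Bool) :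
    Percept Unit 2 :=
  (if u (h.map Prod.fst) then 2 else if y then 0 else 1, ())

/-- The environment with perceptions `lockPercept u`. -/
def lockEnv (u : List Bool → Prop) : Environment Bool Unit 2 := detEnv (lockPercept u)

/-- The actions at times `j, …, t - 1` are all `true`, and this streak is long relative
to its starting time. -/
def LongStreakAt (a : ℕ → Option Bool) (t : ℕ) : Prop :=
  ∃ j, j + j / 2 ≤ t ∧ ∀ i, j ≤ i → i < t → a i = some true

/-- Some long streak of `true` has been completed at a time not before `s`. -/
def Unlocked (s : ℕ) (l : List Bool) : Prop :=
  ∃ t ≤ l.length, s ≤ t ∧ LongStreakAt (fun i => l[i]?) t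

theorem length_detHist_lockEnv (u : List Bool → Prop) (p : Policy Bool Unit 2) (n : ℕ) :
    (detHist (lockEnv u) p n).length = n := by
  rw [lockEnv, detHist_detEnv, genHist_eq_map_range]
  simp

theorem rew_detZ_lockEnv (u : List Bool → Prop) (p : Policy Bool Unit 2) (n : ℕ) :
    rew (detZ (lockEnv u) p n) =
      if u ((List.range n).map fun i => (detZ (lockEnv u) p i).1) then 2
      else if (detZ (lockEnv u) p n).1 then 0 else 1 := by
  have h : (genHist (lockPercept u) p n).map Prod.fst =
      (List.range n).map fun i => (genTraj (lockPercept u) p i).1 := by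
    rw [genHist_eq_map_range, List.map_map]
    rfl
  simp only [lockEnv, detZ_detEnv]
  rw [← h]
  simp only [rew, genTraj, lockPercept]
  split_ifs <;> simp [*]

theorem rew_detZ_lockEnv_false (p : Policy Bool Unit 2) (n : ℕ) :
    rew (detZ (lockEnv fun _ => False) p n) =
      if (detZ (lockEnv fun _ => False) p n).1 then 0 else 1 := by
  rw [rew_detZ_lockEnv, if_neg id]

theorem unlocked_map_range_iff (s n : ℕ) (a : ℕ → Bool) :
    Unlocked s ((List.range n).map a) ↔
      ∃ t ≤ n, s ≤ t ∧ LongStreakAt (fun i => some (a i)) t := by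
  simp only [Unlocked, LongStreakAt, List.length_map, List.length_range]
  refine exists_congr fun t => and_congr_right fun ht => and_congr_right fun _ =>
    exists_congr fun j => and_congr_right fun _ => forall_congr' fun i => forall_congr' fun _ =>
    forall_congr' fun hi => ?_
  simp [List.getElem?_range (hi.trans_le ht)]

theorem lockEnv_P_eq_one_iff (u : List Bool → Prop) (p : Policy Bool Unit 2)
    (s : Set (Traj Bool Unit 2)) : (lockEnv u).P p s = 1 ↔ detZ (lockEnv u) p ∈ s := by
  rw [lockEnv, detEnv_P_eq_one_iff, detZ_detEnv]

theorem detZ_lockEnv_fst_of_length (u : List Bool → Prop) (a : ℕ → Bool) (n : ℕ) :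
    (detZ (lockEnv u) (fun l => a l.length) n).1 = a n := by
  simp only [detZ, length_detHist_lockEnv]

/-- The locked environment in which nothing can be unlocked has optimal value `1`. -/
theorem valueIs_lockEnv_false :
    ValueIs (lockEnv fun _ => False) (fun _ => false) 1 := by
  rw [ValueIs, lockEnv_P_eq_one_iff]
  refine tendsto_avg_of_eventually_eq (Eventually.of_forall fun i => ?_)
  rw [rew_detZ_lockEnv_false]
  rfl

theorem limsup_lockEnv_false_le (q : Policy Bool Unit 2) :
    (lockEnv fun _ => False).P q {ω | limsup (avg ω) atTop ≤ 1} = 1 := by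
  rw [lockEnv_P_eq_one_iff]
  refine limsup_avg_le zero_le_one fun i => ?_
  rw [rew_detZ_lockEnv_false]
  split_ifs <;> norm_num

theorem rew_detZ_lockEnv_unlocked_eq_two {s k n : ℕ} (a : ℕ → Bool)
    (ha : ∀ i, k ≤ i → a i = true) (hs : s ≤ n) (hk : k + k / 2 ≤ n) :
    rew (detZ (lockEnv (Unlocked s)) (fun l => a l.length) n) = 2 := by
  rw [rew_detZ_lockEnv, if_pos]
  simp only [detZ_lockEnv_fst_of_length]
  rw [unlocked_map_range_iff]
  exact ⟨n, le_rfl, hs, k, hk, fun i hi _ => congrArg some (ha i hi)⟩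

theorem rew_detZ_lockEnv_unlocked_true (s n : ℕ) :
    rew (detZ (lockEnv (Unlocked s)) (fun _ => true) n) = if s ≤ n then 2 else 0 := by
  split_ifs with h
  · exact rew_detZ_lockEnv_unlocked_eq_two (k := 0) (fun _ => true) (fun _ _ => rfl) h
      (Nat.zero_le _)
  · rw [rew_detZ_lockEnv, if_neg]
    · rfl
    · rw [unlocked_map_range_iff]
      rintro ⟨t, ht, hst, -⟩
      exact h (hst.trans ht)

theorem valueIs_lockEnv_unlocked (s : ℕ) :
    ValueIs (lockEnv (Unlocked s)) (fun _ => true) 2 := by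
  rw [ValueIs, lockEnv_P_eq_one_iff]
  refine tendsto_avg_of_eventually_eq ((eventually_ge_atTop s).mono fun i hi => ?_)
  rw [rew_detZ_lockEnv_unlocked_true, if_pos hi]

theorem limsup_lockEnv_le_two (u : List Bool → Prop) (q : Policy Bool Unit 2) :
    (lockEnv u).P q {ω | limsup (avg ω) atTop ≤ 2} = 1 := by
  rw [lockEnv_P_eq_one_iff]
  exact limsup_avg_le zero_le_two fun i => by simpa using rew_le (detZ (lockEnv u) q i)

theorem le_of_isOptimalValue_lockEnv {u : List Bool → Prop} {p : Policy Bool Unit 2} {V W : ℝ}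
    (hp : ValueIs (lockEnv u) p W) (hV : IsOptimalValue (lockEnv u) V) : W ≤ V := by
  obtain ⟨-, -, h⟩ := hV
  have h₁ := h p
  rw [lockEnv_P_eq_one_iff] at h₁
  rw [ValueIs, lockEnv_P_eq_one_iff] at hp
  exact hp.limsup_eq.symm.trans_le h₁

/-- After `k` arbitrary actions, playing `true` forever loses at most `k` in `Unlocked s`. -/
theorem sum_rew_lockEnv_unlocked_le (s k n : ℕ) (acts : ℕ → Bool) :
    (∑ i ∈ Finset.Icc k (k + n), rew (detZ (lockEnv (Unlocked s)) (fun _ => true) i)) ≤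
      (∑ i ∈ Finset.Icc k (k + n), rew (detZ (lockEnv (Unlocked s))
        (fun l => if l.length < k then acts l.length else true) i)) + k := by
  set p : Policy Bool Unit 2 := fun l => if l.length < k then acts l.length else true
  have hpt : ∀ i ∈ Finset.Icc k (k + n),
      rew (detZ (lockEnv (Unlocked s)) (fun _ => true) i) ≤
        rew (detZ (lockEnv (Unlocked s)) p i) + if i ∈ Finset.Ico k (k + k / 2) then 2 else 0 := by
    intro i hi
    have hk := (Finset.mem_Icc.mp hi).1
    have h₀ := rew_nonneg (detZ (lockEnv (Unlocked s)) p i)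
    rw [rew_detZ_lockEnv_unlocked_true]
    by_cases h₁ : i ∈ Finset.Ico k (k + k / 2)
    · rw [if_pos h₁]
      split_ifs <;> linarith
    · rw [if_neg h₁, add_zero]
      split_ifs with hs
      · refine (rew_detZ_lockEnv_unlocked_eq_two (k := k)
          (fun i => if i < k then acts i else true) (fun i hi => if_neg hi.not_gt) hs ?_).ge
        simp only [Finset.mem_Ico, not_and, not_lt] at h₁
        exact h₁ hk
      · exact h₀
  refine (Finset.sum_le_sum hpt).trans ?_
  rw [Finset.sum_add_distrib]
  gcongr
  rw [← Finset.sum_filter, Finset.sum_const, nsmul_eq_mul]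
  have hcard : #{i ∈ Finset.Icc k (k + n) | i ∈ Finset.Ico k (k + k / 2)} ≤ k / 2 :=
    calc _ ≤ #(Finset.Ico k (k + k / 2)) :=
          Finset.card_le_card fun i hi => (Finset.mem_filter.mp hi).2
      _ = k / 2 := by simp
  have : #{i ∈ Finset.Icc k (k + n) | i ∈ Finset.Ico k (k + k / 2)} * 2 ≤ k := by omega
  exact_mod_cast this

theorem avg_lockEnv_false_le_of_longStreakAt {p : Policy Bool Unit 2} {t : ℕ} (ht : 4 ≤ t)
    (h : LongStreakAt (fun i => some (detZ (lockEnv fun _ => False) p i).1) t) :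
    avg (detZ (lockEnv fun _ => False) p) t ≤ 3 / 4 := by
  obtain ⟨j, hj, hstreak⟩ := h
  have htpos : (0 : ℝ) < t := by exact_mod_cast (by omega : 0 < t)
  rw [avg, div_le_iff₀ htpos]
  have hsum : ∑ i ∈ Finset.range t, rew (detZ (lockEnv fun _ => False) p i) ≤ j := by
    calc _ ≤ ∑ i ∈ Finset.range t, if i ∈ Finset.range j then (1 : ℝ) else 0 := by
          refine Finset.sum_le_sum fun i hi => ?_
          rw [rew_detZ_lockEnv_false]
          by_cases hij : i < j
          · rw [if_pos (Finset.mem_range.mpr hij)]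
            split_ifs <;> norm_num
          · have := hstreak i (not_lt.mp hij) (Finset.mem_range.mp hi)
            simp [Option.some.inj this, hij]
      _ = j := by
          rw [Finset.sum_ite_mem, Finset.inter_eq_right.mpr]
          · simp
          · exact Finset.range_subset_range.mpr (by omega)
  have : (4 * j : ℝ) ≤ 3 * t := by exact_mod_cast (by omega : 4 * j ≤ 3 * t)
  linarith

/-- A policy with only finitely many long streaks when nothing can be unlocked never unlocks
anything in `Unlocked s`, for `s` beyond all those streaks. -/
theorem detHist_lockEnv_unlocked_eq {p : Policy Bool Unit 2} {s : ℕ}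
    (hs : ∀ t, s ≤ t →
      ¬ LongStreakAt (fun i => some (detZ (lockEnv fun _ => False) p i).1) t) (n : ℕ) :
    detHist (lockEnv (Unlocked s)) p n = detHist (lockEnv fun _ => False) p n := by
  induction n with
  | zero => rfl
  | succ n ih =>
    have h : ¬ Unlocked s ((detHist (lockEnv fun _ => False) p n).map Prod.fst) := by
      have : (detHist (lockEnv fun _ => False) p n).map Prod.fst =
          (List.range n).map fun i => (detZ (lockEnv fun _ => False) p i).1 := by
        simp only [lockEnv, detHist_detEnv, detZ_detEnv, genHist_eq_map_range, List.map_map]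
        rfl
      rw [this, unlocked_map_range_iff]
      rintro ⟨t, -, hst, ht⟩
      exact hs t hst ht
    simp only [detHist, ih]
    simp only [lockEnv, pick_detEnv] at h ⊢
    simp only [lockPercept, if_neg h, if_false]

theorem detZ_lockEnv_unlocked_eq {p : Policy Bool Unit 2} {s : ℕ}
    (hs : ∀ t, s ≤ t →
      ¬ LongStreakAt (fun i => some (detZ (lockEnv fun _ => False) p i).1) t) :
    detZ (lockEnv (Unlocked s)) p = detZ (lockEnv fun _ => False) p := by
  funext n
  have h := detHist_lockEnv_unlocked_eq hs (n + 1)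
  simp only [detHist] at h
  exact List.singleton_injective (List.append_inj_right h
    (by rw [length_detHist_lockEnv, length_detHist_lockEnv]))

/-- The environments `lockEnv (Unlocked s)`, together with the one that stays locked. -/
def lockFamily : Set (Environment Bool Unit 2) :=
  insert (lockEnv fun _ => False) (Set.range fun s => lockEnv (Unlocked s))

theorem exists_liminf_lt_of_policy (p : Policy Bool Unit 2) :
    ∃ ν ∈ lockFamily, ∀ V, IsOptimalValue ν V →
      liminf (avg fun i => detZ ν p i) atTop < V := by
  by_cases hfreq : ∃ᶠ t in atTop,
      LongStreakAt (fun i => some (detZ (lockEnv fun _ => False) p i).1) t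
  · refine ⟨_, Set.mem_insert _ _, fun V hV => ?_⟩
    have h₁ := le_of_isOptimalValue_lockEnv valueIs_lockEnv_false hV
    have h₂ : liminf (avg fun i => detZ (lockEnv fun _ => False) p i) atTop ≤ 3 / 4 :=
      liminf_avg_le_of_frequently ((hfreq.and_eventually (eventually_ge_atTop 4)).mono
        fun t ht => avg_lockEnv_false_le_of_longStreakAt ht.2 ht.1)
    linarith
  · obtain ⟨s, hs⟩ := eventually_atTop.mp (not_frequently.mp hfreq)
    refine ⟨_, Set.mem_insert_of_mem _ ⟨s, rfl⟩, fun V hV => ?_⟩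
    have h₁ := le_of_isOptimalValue_lockEnv (valueIs_lockEnv_unlocked s) hV
    have h₂ : liminf (avg fun i => detZ (lockEnv (Unlocked s)) p i) atTop ≤ 1 := by
      rw [detZ_lockEnv_unlocked_eq hs]
      refine liminf_avg_le_of_frequently
        (Eventually.of_forall (avg_le zero_le_one fun i => ?_)).frequently
      rw [rew_detZ_lockEnv_false]
      split_ifs <;> norm_num
    exact h₂.trans_lt (by linarith)

theorem explorable_of_mem_lockFamily {ν : Environment Bool Unit 2} (hν : ν ∈ lockFamily) :
    Explorable ν := by
  rcases hν with rfl | ⟨s, rfl⟩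
  · exact ⟨1, _, valueIs_lockEnv_false, limsup_lockEnv_false_le⟩
  · exact ⟨2, _, valueIs_lockEnv_unlocked s, limsup_lockEnv_le_two _⟩

theorem not_selfOptimizing_lockFamily (p : Policy Bool Unit 2) :
    ¬ SelfOptimizing p lockFamily := by
  intro hp
  obtain ⟨ν, hν, hlt⟩ := exists_liminf_lt_of_policy p
  obtain ⟨V, hV⟩ := explorable_of_mem_lockFamily hν
  have hval := hp ν hν V hV
  have hlim : Tendsto (avg (detZ ν p)) atTop (nhds V) := by
    rcases hν with rfl | ⟨s, rfl⟩ <;> exact (lockEnv_P_eq_one_iff _ _ _).mp hval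
  exact (hlt V hV).ne hlim.liminf_eq

end LockEnvironment

/-- **Proposition (necessity of `d(k,ε) = o(k)`).**
There exists a countable family `C` of deterministic explorable environments (two actions,
rewards in `{0,1,2}`, no observations) such that: (1) for every `ν ∈ C` and every finite
sequence of actions `y_{<k}` there exists a policy `p`, taking these `k` actions first,
with `r^ν_{k..k+n} ≤ r^{pν}_{k..k+n} + k` for all `n ≥ k`, where `r^ν_i` are the rewards
attained by an optimal policy `p_ν` which acted optimally from the beginning; but (2) for
every policy `p` there exists `ν ∈ C` with `V̲(ν,p) < V*_ν`; in particular there is no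
self-optimizing policy for `C`. -/
theorem necessity_of_sublinear_d :
    ∃ C : Set (Environment Bool Unit 2), C.Countable ∧
      (∀ ν ∈ C, Deterministic ν ∧ Explorable ν) ∧
      (∀ ν ∈ C, ∃ (pν : Policy Bool Unit 2) (V : ℝ),
        ValueIs ν pν V ∧
        (∀ q : Policy Bool Unit 2, ν.P q {ω | limsup (avg ω) atTop ≤ V} = 1) ∧
        ∀ (acts : ℕ → Bool) (k : ℕ), ∃ p : Policy Bool Unit 2,
          (∀ i < k, (detZ ν p i).1 = acts i) ∧
          ∀ n, k ≤ n →
            (∑ i ∈ Finset.Icc k (k + n), rew (detZ ν pν i))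
              ≤ (∑ i ∈ Finset.Icc k (k + n), rew (detZ ν p i)) + k) ∧
      (∀ p : Policy Bool Unit 2, ∃ ν ∈ C, ∀ V, IsOptimalValue ν V →
        liminf (avg fun i => detZ ν p i) atTop < V) ∧
      ¬ ∃ p : Policy Bool Unit 2, SelfOptimizing p C := by
  refine ⟨lockFamily, (Set.countable_range _).insert _, fun ν hν => ⟨?_, ?_⟩, ?_,
    exists_liminf_lt_of_policy, fun ⟨p, hp⟩ => not_selfOptimizing_lockFamily p hp⟩
  · rcases hν with rfl | ⟨s, rfl⟩ <;> exact deterministic_detEnv _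
  · exact explorable_of_mem_lockFamily hν
  · rintro ν (rfl | ⟨s, rfl⟩)
    · refine ⟨_, 1, valueIs_lockEnv_false, limsup_lockEnv_false_le, fun acts k =>
        ⟨fun l => if l.length < k then acts l.length else false, fun i hi => ?_, fun n _ => ?_⟩⟩
      · rw [detZ_lockEnv_fst_of_length _ fun i => if i < k then acts i else false, if_pos hi]
      · refine (Finset.sum_le_sum fun i hi => ?_).trans (le_add_of_nonneg_right k.cast_nonneg)
        rw [rew_detZ_lockEnv_false, rew_detZ_lockEnv_false,
          detZ_lockEnv_fst_of_length _ fun i => if i < k then acts i else false,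
          if_neg (Finset.mem_Icc.mp hi).1.not_gt]
        exact le_rfl
    · refine ⟨_, 2, valueIs_lockEnv_unlocked s, limsup_lockEnv_le_two _, fun acts k =>
        ⟨fun l => if l.length < k then acts l.length else true, fun i hi => ?_, fun n _ =>
          sum_rew_lockEnv_unlocked_le s k n acts⟩⟩
      rw [detZ_lockEnv_fst_of_length _ fun i => if i < k then acts i else true, if_pos hi]

end RL
end
end
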